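/- Let (f_w) denote the sequence of normalized extremal quasimodular forms of depth 4 and even weight w ≥ 12, and let w ≡ 0 (mod 12). Then f_12 = (13025 E_4^3 − 12796 E_6^2 + 3852 E_2E_4E_6 − 2706 E_2^2E_4^2 + 27500 E_2^3E_6 − 28875 E_2^4E_4)/7449432883200, and the following hold: f_{w+2} = (3/(w+1)) ∂_{w−4} f_w, and f_{w+4} = ((5w+12)^4/(2^6·3^5·(w+1)(w+2)^5)) · (((w+1)(2w+1)/18) E_4 f_w − ∂_{w−4}^2 f_w). -/

import Mathlib

open Complex UpperHalfPlane Finset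
open scoped Manifold MatrixGroups Real

noncomputable section

/-- The nome `q = e^{2πiz}`. -/
def qexp (z : ℍ) : ℂ := Complex.exp (2 * Real.pi * Complex.I * z)

/-- The normalized Eisenstein series `E_k` (for even `k ≥ 2`), defined via its
`q`-expansion `E_k = 1 - (2k/B_k) ∑_{n ≥ 1} σ_{k-1}(n) q^n`. -/
def Eis (k : ℕ) (z : ℍ) : ℂ :=
  1 - (2 * k / ((bernoulli k : ℚ) : ℂ)) *
    ∑' n : ℕ, (ArithmeticFunction.sigma (k - 1) (n + 1) : ℂ) * qexp z ^ (n + 1)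

/-- The modular discriminant `Δ = (E_4³ − E_6²)/1728`. -/
def Disc (z : ℍ) : ℂ := (Eis 4 z ^ 3 - Eis 6 z ^ 2) / 1728

/-- The space of holomorphic modular forms of weight `w` for the full modular group,
as a set of functions on `ℍ`. -/
def Mset (w : ℤ) : Set (ℍ → ℂ) :=
  {f | ∃ F : ModularForm (⊤ : Subgroup SL(2, ℤ)) w, ⇑F = f}

/-- The set of quasimodular forms of weight `w` and depth `≤ r`:
functions of the form `∑_{ℓ=0}^r E_2^ℓ h_ℓ` with `h_ℓ ∈ M_{w-2ℓ}`. -/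
def QMset (w : ℤ) (r : ℕ) : Set (ℍ → ℂ) :=
  {f | ∃ h : ℕ → ℍ → ℂ, (∀ ℓ ≤ r, h ℓ ∈ Mset (w - 2 * ℓ)) ∧
        ∀ z, f z = ∑ ℓ ∈ Finset.range (r + 1), Eis 2 z ^ ℓ * h ℓ z}

/-- `QM_w^r` as a `ℂ`-subspace of the functions on `ℍ`. -/
def QM (w : ℤ) (r : ℕ) : Submodule ℂ (ℍ → ℂ) := Submodule.span ℂ (QMset w r)

/-- `dim QM_w^r`. -/
def dimQM (w : ℤ) (r : ℕ) : ℕ := Module.finrank ℂ (QM w r)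

/-- The complex derivative of a function on `ℍ` (via an extension to `ℂ`; since `ℍ` is
open in `ℂ` this agrees with the complex derivative for holomorphic `f`). -/
def hderiv (f : ℍ → ℂ) (z : ℍ) : ℂ :=
  deriv (fun w : ℂ => if h : 0 < w.im then f ⟨w, h⟩ else 0) z

/-- The normalized derivative `f' = (2πi)⁻¹ df/dz = q df/dq`. -/
def qderiv (f : ℍ → ℂ) (z : ℍ) : ℂ := (2 * Real.pi * Complex.I)⁻¹ * hderiv f z

/-- The Serre derivative `∂_w f = f' - (w/12) E_2 f`. -/
def serre (w : ℤ) (f : ℍ → ℂ) (z : ℍ) : ℂ :=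
  qderiv f z - ((w : ℂ) / 12) * Eis 2 z * f z

/-- Iterated Serre derivatives: `∂_w^0 f = f`, `∂_w^{k+1} f = ∂_{w+2k}(∂_w^k f)`. -/
def serreIter (w : ℤ) : ℕ → (ℍ → ℂ) → (ℍ → ℂ)
  | 0, f => f
  | (k + 1), f => serre (w + 2 * k) (serreIter w k f)

/-- `z ↦ -1/z` as a map `ℍ → ℍ`. -/
def Sact (z : ℍ) : ℍ :=
  ⟨-(z : ℂ)⁻¹, by
    have h0 : (z : ℂ) ≠ 0 := z.ne_zero
    have : (-(z : ℂ)⁻¹).im = (z : ℂ).im / Complex.normSq (z : ℂ) := by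
      rw [Complex.neg_im, Complex.inv_im]; ring
    rw [this]
    exact div_pos z.im_pos (Complex.normSq_pos.mpr h0)⟩

/-- `z ↦ z + 1` as a map `ℍ → ℍ`. -/
def Tact (z : ℍ) : ℍ := ⟨(z : ℂ) + 1, by simpa using z.im_pos⟩

/-- `g` has a `q`-expansion with vanishing order exactly `ν` at `i∞`:
`g = q^ν ∑_{n≥0} a(n) qⁿ` with `a(0) ≠ 0`. -/
def HasQExpansionAt (g : ℍ → ℂ) (ν : ℕ) : Prop :=
  ∃ a : ℕ → ℂ, a 0 ≠ 0 ∧ ∀ z : ℍ, HasSum (fun n : ℕ => a n * qexp z ^ (ν + n)) (g z)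

/-- The quasimodular forms `g_ℓ` attached to `f = ∑_{ℓ=0}^r E_2^ℓ h_ℓ`, defined by
`C(r,ℓ) g_ℓ = (6/(πi))^ℓ ∑_{m=0}^{r-ℓ} C(ℓ+m,m) E_2^m h_{ℓ+m}`. -/
def gOf (r : ℕ) (h : ℕ → ℍ → ℂ) (ℓ : ℕ) (z : ℍ) : ℂ :=
  ((r.choose ℓ : ℂ))⁻¹ * (6 / ((Real.pi : ℂ) * Complex.I)) ^ ℓ *
    ∑ m ∈ Finset.range (r - ℓ + 1), (((ℓ + m).choose m : ℕ) : ℂ) * Eis 2 z ^ m * h (ℓ + m) z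

/-- `f` is a balanced quasimodular form of weight `w` and depth `r`. -/
def IsBalancedQM (w : ℤ) (r : ℕ) (f : ℍ → ℂ) : Prop :=
  ∃ h : ℕ → ℍ → ℂ, ∃ lam : ℕ → ℕ,
    (∀ ℓ ≤ r, h ℓ ∈ Mset (w - 2 * ℓ)) ∧ h r ≠ 0 ∧
    (∀ z, f z = ∑ ℓ ∈ Finset.range (r + 1), Eis 2 z ^ ℓ * h ℓ z) ∧
    (∀ ℓ ≤ r, HasQExpansionAt (gOf r h ℓ) (lam ℓ)) ∧
    (∀ i j, i ≤ j → j ≤ r → lam j ≤ lam i) ∧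
    (∀ ℓ ≤ r, lam ℓ < dimQM (w - 2 * ℓ) (r - ℓ)) ∧
    (∑ ℓ ∈ Finset.range (r + 1), lam ℓ) = dimQM w r - 1

/-- `f` is the normalized extremal quasimodular form of weight `w` and depth `r`:
`f ∈ QM_w^r` with `q`-expansion `q^{dim QM_w^r - 1}(1 + O(q))`. -/
def IsNormalizedExtremalQM (w : ℤ) (r : ℕ) (f : ℍ → ℂ) : Prop :=
  f ∈ QM w r ∧ ∃ a : ℕ → ℂ, a 0 = 1 ∧
    ∀ z : ℍ, HasSum (fun n : ℕ => a n * qexp z ^ (dimQM w r - 1 + n)) (f z)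

/-- `f 0, …, f (n-1)` is a fundamental system of solutions of the linear differential
equation `K g = 0`: holomorphic linearly independent solutions spanning all
holomorphic solutions. -/
def IsFundamentalSystem {n : ℕ} (K : (ℍ → ℂ) → (ℍ → ℂ)) (f : Fin n → ℍ → ℂ) : Prop :=
  (∀ i, MDifferentiable 𝓘(ℂ) 𝓘(ℂ) (f i)) ∧ (∀ i, K (f i) = 0) ∧
    LinearIndependent ℂ f ∧
    ∀ g : ℍ → ℂ, MDifferentiable 𝓘(ℂ) 𝓘(ℂ) g → K g = 0 → g ∈ Submodule.span ℂ (Set.range f)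


/-- `F = (f_0, …, f_r)ᵀ` is a quasimodular vector of weight `w` and dimension `r+1`:
all components are holomorphic and there is a quasimodular form `f = ∑_{ℓ=0}^s E_2^ℓ h_ℓ`
of weight `w` and depth `s ≤ r` such that
`f_k(z) = ∑_{ℓ=0}^{min(k,s)} C(k,ℓ) z^{k-ℓ} g_ℓ(z)` for the attached forms `g_ℓ`. -/
def IsQuasimodularVector (w : ℤ) (r : ℕ) (F : Fin (r + 1) → ℍ → ℂ) : Prop :=
  (∀ k, MDifferentiable 𝓘(ℂ) 𝓘(ℂ) (F k)) ∧
  ∃ s : ℕ, s ≤ r ∧ ∃ h : ℕ → ℍ → ℂ,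
    (∀ ℓ ≤ s, h ℓ ∈ Mset (w - 2 * ℓ)) ∧ (s = 0 ∨ h s ≠ 0) ∧
    ∀ (k : Fin (r + 1)) (z : ℍ),
      F k z = ∑ ℓ ∈ Finset.range (min (k : ℕ) s + 1),
        (((k : ℕ).choose ℓ : ℕ) : ℂ) * (z : ℂ) ^ ((k : ℕ) - ℓ) * gOf s h ℓ z

/-- The modular Wronskian `W(z) = det(F, ∂_{w-r}F, …, ∂_{w-r}^r F)`. -/
def modularWronskian (w : ℤ) (r : ℕ) (F : Fin (r + 1) → ℍ → ℂ) (z : ℍ) : ℂ :=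
  Matrix.det (Matrix.of fun (k j : Fin (r + 1)) => serreIter (w - r) (j : ℕ) (F k) z)

end

/-- The function `f` on `ℍ` is everywhere the sum of the power series `p` in the nome. -/
def HasQ (f : ℍ → ℂ) (p : PowerSeries ℂ) : Prop :=
  ∀ z, HasSum (fun n => PowerSeries.coeff n p * qexp z ^ n) (f z)

theorem qexp_eq_qParam (z : ℍ) : qexp z = Function.Periodic.qParam 1 z := by
  simp [qexp, Function.Periodic.qParam]

theorem HasQ.ext {f g : ℍ → ℂ} {p : PowerSeries ℂ} (hf : HasQ f p) (hg : HasQ g p) : f = g :=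
  funext fun z => (hf z).unique (hg z)

theorem HasQ.add {f g : ℍ → ℂ} {p r : PowerSeries ℂ} (hf : HasQ f p) (hg : HasQ g r) :
    HasQ (f + g) (p + r) := fun z => by
  simpa [add_mul] using (hf z).add (hg z)

theorem HasQ.smul {f : ℍ → ℂ} {p : PowerSeries ℂ} (c : ℂ) (hf : HasQ f p) :
    HasQ (c • f) (c • p) := fun z => by
  simpa [mul_assoc] using (hf z).mul_left c

theorem HasQ.sub {f g : ℍ → ℂ} {p r : PowerSeries ℂ} (hf : HasQ f p) (hg : HasQ g r) :
    HasQ (f - g) (p - r) := fun z => by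
  simpa [sub_mul] using (hf z).sub (hg z)

theorem HasQ.mul {f g : ℍ → ℂ} {p r : PowerSeries ℂ} (hf : HasQ f p) (hg : HasQ g r) :
    HasQ (f * g) (p * r) := fun z => by
  have h := summable_norm_sum_mul_antidiagonal_of_summable_norm (hf z).summable.norm
    (hg z).summable.norm
  have h2 := tsum_mul_tsum_eq_tsum_sum_antidiagonal_of_summable_norm (hf z).summable.norm
    (hg z).summable.norm
  rw [(hf z).tsum_eq, (hg z).tsum_eq] at h2
  have h3 := h.of_norm.hasSum
  rw [← h2] at h3
  refine h3.congr_fun fun n => ?_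
  rw [PowerSeries.coeff_mul, Finset.sum_mul]
  refine Finset.sum_congr rfl fun x hx => ?_
  rw [← Finset.HasAntidiagonal.mem_antidiagonal.mp hx, pow_add]
  ring

theorem hasQ_one : HasQ 1 1 := fun z => by
  have := hasSum_single (f := fun n => PowerSeries.coeff n (1 : PowerSeries ℂ) * qexp z ^ n) 0
    (fun n hn => by simp [PowerSeries.coeff_one, hn])
  simpa using this

theorem hasQ_zero : HasQ 0 0 := fun z => by simp

theorem HasQ.pow {f : ℍ → ℂ} {p : PowerSeries ℂ} (hf : HasQ f p) (n : ℕ) :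
    HasQ (f ^ n) (p ^ n) := by
  induction n with
  | zero => simpa using hasQ_one
  | succ n ih => simpa [pow_succ] using ih.mul hf

theorem HasQ.sum {ι : Type*} (s : Finset ι) {f : ι → ℍ → ℂ} {p : ι → PowerSeries ℂ}
    (h : ∀ i ∈ s, HasQ (f i) (p i)) : HasQ (∑ i ∈ s, f i) (∑ i ∈ s, p i) := by
  classical
  induction s using Finset.induction_on with
  | empty => simpa using hasQ_zero
  | insert a s ha ih =>
    rw [Finset.sum_insert ha, Finset.sum_insert ha]
    exact (h a (by simp)).add (ih fun i hi => h i (by simp [hi]))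

theorem HasQ.unique {f : ℍ → ℂ} {p r : PowerSeries ℂ} (hp : HasQ f p) (hr : HasQ f r) :
    p = r := by
  have h := hp.sub hr
  rw [sub_self] at h
  rw [← sub_eq_zero]
  ext n
  have := ModularFormClass.qExpansion_coeff_unique (k := 0) (Γ := 𝒮ℒ)
    (f := (0 : ModularForm 𝒮ℒ 0)) (c := fun n => PowerSeries.coeff n (p - r)) one_pos
    one_mem_strictPeriods_SL (fun z => by simpa [qexp_eq_qParam] using h z) n
  simpa [UpperHalfPlane.qExpansion_zero] using this

/-- The operator `12 X d/dX` on power series. -/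
noncomputable def theta : Derivation ℂ (PowerSeries ℂ) (PowerSeries ℂ) :=
  (12 * PowerSeries.X : PowerSeries ℂ) • PowerSeries.derivative ℂ

theorem coeff_theta (p : PowerSeries ℂ) (n : ℕ) :
    PowerSeries.coeff n (theta p) = 12 * n * PowerSeries.coeff n p := by
  have h12 : (12 : PowerSeries ℂ) = PowerSeries.C (12 : ℂ) := (map_ofNat _ 12).symm
  rw [theta, Derivation.smul_apply, smul_eq_mul, h12, mul_assoc, PowerSeries.coeff_C_mul]
  cases n with
  | zero => simp
  | succ n =>
    rw [PowerSeries.coeff_succ_X_mul]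
    simp [PowerSeries.coeff_derivative]
    ring

theorem hderiv_eq_deriv_comp_ofComplex (f : ℍ → ℂ) (z : ℍ) :
    hderiv f z = deriv (f ∘ ofComplex) z := by
  refine Filter.EventuallyEq.deriv_eq ?_
  filter_upwards [isOpen_upperHalfPlaneSet.mem_nhds z.im_pos] with w hw
  have hw' : 0 < w.im := hw
  simp [hw', ofComplex_apply_of_im_pos hw']

theorem HasQ.qderiv {f : ℍ → ℂ} {p : PowerSeries ℂ} (hf : HasQ f p) :
    HasQ ((12 : ℂ) • qderiv f) (theta p) := fun z => by
  set F : ℕ → ℂ → ℂ := fun n w =>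
    PowerSeries.coeff n p * Complex.exp (2 * π * Complex.I * w) ^ n with hF
  have hz := z.im_pos
  let z₀ : ℍ := ⟨((z.im / 2 : ℝ) : ℂ) * Complex.I, by simpa using hz⟩
  have hu := (hf z₀).summable.norm
  have hU : IsOpen {w : ℂ | z.im / 2 < w.im} := isOpen_lt continuous_const Complex.continuous_im
  have hbound : ∀ n, ∀ w ∈ {w : ℂ | z.im / 2 < w.im},
      ‖F n w‖ ≤ ‖PowerSeries.coeff n p * qexp z₀ ^ n‖ := by
    intro n w hw
    simp only [hF, norm_mul, norm_pow]
    gcongr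
    rw [qexp, Complex.norm_exp, Complex.norm_exp]
    have hw' : z.im / 2 < w.im := hw
    have h₀ : z₀.im = z.im / 2 := by
      change (((z.im / 2 : ℝ) : ℂ) * Complex.I).im = z.im / 2
      simp
    refine Real.exp_le_exp.mpr ?_
    simp [h₀]
    nlinarith [Real.pi_pos]
  have key := Complex.hasSum_deriv_of_summable_norm (z := (z : ℂ)) hu
    (fun n => by fun_prop) hU hbound (show z.im / 2 < (z : ℂ).im by simp; linarith)
  have hd : deriv (fun w => ∑' n, F n w) z = hderiv f z := by
    refine Filter.EventuallyEq.deriv_eq ?_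
    filter_upwards [isOpen_upperHalfPlaneSet.mem_nhds z.im_pos] with w hw
    have hw' : 0 < w.im := hw
    rw [dif_pos hw']
    exact (hf ⟨w, hw'⟩).tsum_eq
  rw [hd] at key
  have h2 := key.mul_left (12 * (2 * π * Complex.I)⁻¹)
  simp only [Pi.smul_apply, _root_.qderiv, smul_eq_mul, ← mul_assoc]
  refine h2.congr_fun fun n => ?_
  have hder : HasDerivAt (F n)
      (PowerSeries.coeff n p * (n * qexp z ^ n * (2 * π * Complex.I))) z := by
    have h1 : HasDerivAt (fun w : ℂ => Complex.exp (n * (2 * π * Complex.I * w)))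
        (qexp z ^ n * (n * (2 * π * Complex.I * 1))) z := by
      have := (((hasDerivAt_id (z : ℂ)).const_mul (2 * π * Complex.I)).const_mul (n : ℂ)).cexp
      simpa [qexp, Complex.exp_nat_mul] using this
    have h3 := h1.const_mul (PowerSeries.coeff n p)
    simp only [hF, ← Complex.exp_nat_mul]
    exact h3.congr_deriv (by ring)
  rw [hder.deriv, coeff_theta]
  field_simp

theorem hasQ_modularForm {k : ℤ} (F : ModularForm 𝒮ℒ k) : HasQ F (qExpansion 1 F) := fun z => by
  simpa [qexp_eq_qParam] using ModularForm.hasSum_qExpansion F one_pos one_mem_strictPeriods_SL z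

/-- The space of `q`-expansions of modular forms of weight `k` and level one. -/
noncomputable def MS (k : ℤ) : Submodule ℂ (PowerSeries ℂ) where
  carrier := {p | ∃ F : ModularForm 𝒮ℒ k, HasQ F p}
  add_mem' := by
    rintro _ _ ⟨F, hF⟩ ⟨G, hG⟩
    exact ⟨F + G, hF.add hG⟩
  zero_mem' := ⟨0, hasQ_zero⟩
  smul_mem' := by
    rintro c _ ⟨F, hF⟩
    exact ⟨c • F, hF.smul c⟩

theorem MS_mul {a b c : ℤ} {p r : PowerSeries ℂ} (hp : p ∈ MS a) (hr : r ∈ MS b)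
    (h : a + b = c) : p * r ∈ MS c := by
  obtain ⟨F, hF⟩ := hp
  obtain ⟨G, hG⟩ := hr
  subst h
  exact ⟨F.mul G, hF.mul hG⟩

theorem one_mem_MS : (1 : PowerSeries ℂ) ∈ MS 0 := ⟨1, hasQ_one⟩

theorem MS_eq_zero_of_X_pow_dvd {k : ℤ} {p : PowerSeries ℂ} (hp : p ∈ MS k) {n : ℕ}
    (hn : k < 12 * n) (hn' : 0 < n) (hdvd : PowerSeries.X ^ n ∣ p) : p = 0 := by
  obtain ⟨F, hF⟩ := hp
  have he := (hasQ_modularForm F).unique hF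
  suffices F = 0 by
    subst this
    exact hF.unique hasQ_zero
  refine ModularForm.sturm_bound_levelOne ?_
  rw [he]
  have h1 : (n : ℕ∞) ≤ p.order := PowerSeries.nat_le_order _ _ (PowerSeries.X_pow_dvd_iff.mp hdvd)
  refine lt_of_lt_of_le (Nat.cast_lt.mpr ?_) h1
  omega

theorem exists_modularForm {k : ℤ} {F : ℍ → ℂ} {p : PowerSeries ℂ}
    (hF : MDifferentiable 𝓘(ℂ) 𝓘(ℂ) F) (hinv : ∀ γ : SL(2, ℤ), (SlashAction.map k γ F) = F)
    (hq : HasQ F p) : ∃ G : ModularForm 𝒮ℒ k, ⇑G = F := by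
  refine ⟨⟨⟨F, fun _ ⟨γ, hγ⟩ ↦ hγ ▸ hinv γ⟩, hF, fun {c} hc => ?_⟩, rfl⟩
  rw [Subgroup.IsArithmetic.isCusp_iff_isCusp_SL2Z] at hc
  rw [OnePoint.isBoundedAt_iff_forall_SL2Z hc]
  intro γ _
  change IsBoundedAtImInfty (SlashAction.map k γ F)
  rw [hinv γ]
  refine isBoundedAtImInfty_of_hasSum_qExpansion (c := fun n => PowerSeries.coeff n p) one_pos
    fun z => ?_
  simpa [qexp_eq_qParam] using hq z

theorem Eis_two : Eis 2 = EisensteinSeries.E2 := by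
  funext z
  rw [EisensteinSeries.E2_eq_tsum_cexp, Eis, bernoulli_two, tsum_pnat_eq_tsum_succ (f := fun n => (ArithmeticFunction.sigma 1 n : ℂ) * cexp (2 * ↑π * Complex.I * ↑z) ^ n)]
  norm_num [qexp]

theorem Eis_eq_E {k : ℕ} (hk : 3 ≤ k) (hk2 : Even k) : Eis k = ModularForm.E hk := by
  funext z
  rw [EisensteinSeries.q_expansion_bernoulli hk hk2, Eis]
  have := tsum_pnat_eq_tsum_succ (f := fun n : ℕ =>
    (ArithmeticFunction.sigma (k - 1) n : ℂ) * cexp (2 * ↑π * Complex.I * ↑z) ^ n)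
  simp only [qexp, zpow_natCast]
  rw [← this]

/-- The `q`-expansion `1 - (2k/B_k) ∑ σ_{k-1}(n) q^n`. -/
noncomputable def eisSeries (k : ℕ) : PowerSeries ℂ :=
  PowerSeries.mk fun n => if n = 0 then 1 else
    -(2 * k / ((bernoulli k : ℚ) : ℂ)) * (ArithmeticFunction.sigma (k - 1) n : ℂ)

/-- The `q`-expansion of `E_2`. -/
noncomputable def eP : PowerSeries ℂ := eisSeries 2
/-- The `q`-expansion of `E_4`. -/
noncomputable def eQ : PowerSeries ℂ := eisSeries 4
/-- The `q`-expansion of `E_6`. -/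
noncomputable def eR : PowerSeries ℂ := eisSeries 6

theorem coeff_eP (n : ℕ) : PowerSeries.coeff n eP =
    if n = 0 then 1 else -24 * (ArithmeticFunction.sigma 1 n : ℂ) := by
  simp [eP, eisSeries, bernoulli_two]
  norm_num

theorem coeff_eQ (n : ℕ) : PowerSeries.coeff n eQ =
    if n = 0 then 1 else 240 * (ArithmeticFunction.sigma 3 n : ℂ) := by
  have : bernoulli 4 = -1 / 30 := by decide +kernel
  simp [eQ, eisSeries, this]
  norm_num

theorem coeff_eR (n : ℕ) : PowerSeries.coeff n eR =
    if n = 0 then 1 else -504 * (ArithmeticFunction.sigma 5 n : ℂ) := by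
  have : bernoulli 6 = 1 / 42 := by decide +kernel
  simp [eR, eisSeries, this]
  norm_num

theorem hasQ_Eis_two : HasQ (Eis 2) eP := fun z => by
  rw [Eis_two]
  simpa [coeff_eP, qexp] using EisensteinSeries.hasSum_qExpansion_E2 z

theorem hasQ_Eis {k : ℕ} (hk : 3 ≤ k) (hk2 : Even k) : HasQ (Eis k) (eisSeries k) := by
  rw [Eis_eq_E hk hk2]
  convert hasQ_modularForm (ModularForm.E hk) using 1
  ext n
  rw [EisensteinSeries.E_qExpansion_coeff hk hk2]
  simp [eisSeries]

theorem hasQ_Eis_four : HasQ (Eis 4) eQ := hasQ_Eis (by norm_num) ⟨2, rfl⟩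
theorem hasQ_Eis_six : HasQ (Eis 6) eR := hasQ_Eis (by norm_num) ⟨3, rfl⟩

theorem eQ_mem : eQ ∈ MS 4 :=
  ⟨ModularForm.E (k := 4) (by norm_num), by
    rw [← Eis_eq_E (by norm_num) ⟨2, rfl⟩]; exact hasQ_Eis_four⟩

theorem eR_mem : eR ∈ MS 6 :=
  ⟨ModularForm.E (k := 6) (by norm_num), by
    rw [← Eis_eq_E (by norm_num) ⟨3, rfl⟩]; exact hasQ_Eis_six⟩

/-- Scaled Serre derivative preserves modularity. -/
theorem theta_sub_mem_MS {k c : ℤ} {p : PowerSeries ℂ} (hp : p ∈ MS k) (hc : k + 2 = c) :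
    theta p - (k : PowerSeries ℂ) * eP * p ∈ MS c := by
  obtain ⟨F, hF⟩ := hp
  subst hc
  have hFd : MDifferentiable 𝓘(ℂ) 𝓘(ℂ) F := F.holo'
  have hq : HasQ ((12 : ℂ) • Derivative.serreDerivative k F) (theta p - (k : PowerSeries ℂ) * eP * p) := by
    have := hF.qderiv.sub ((hasQ_Eis_two.mul hF).smul (k : ℂ))
    convert this using 1
    · funext z
      simp [Derivative.normalizedDerivOfComplex, qderiv, hderiv_eq_deriv_comp_ofComplex, Eis_two]
      ring
    · rw [PowerSeries.smul_eq_C_mul]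
      simp [mul_assoc]
  obtain ⟨G, hG⟩ := exists_modularForm (k := k + 2) (F := (12 : ℂ) • Derivative.serreDerivative k F)
    ((Derivative.serreDerivative_mdifferentiable _ hFd).const_smul _) (fun γ => by
      rw [ModularForm.SL_smul_slash, Derivative.serreDerivative_slash_invariant hFd
        (F.slash_action_eq' _ ⟨γ, rfl⟩)]) hq
  exact ⟨G, hG ▸ hq⟩

theorem normalizedDeriv_E2_slash (γ : SL(2, ℤ)) (z : ℍ) :
    Derivative.normalizedDerivOfComplex (SlashAction.map (2 : ℤ) γ EisensteinSeries.E2) z =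
      Derivative.normalizedDerivOfComplex EisensteinSeries.E2 z +
        1 / (2 * riemannZeta 2) * (γ 1 0 / denom γ z) ^ 2 := by
  have hE : DifferentiableAt ℂ (EisensteinSeries.E2 ∘ ofComplex) z :=
    UpperHalfPlane.mdifferentiableAt_iff.mp (E2_mdifferentiable z)
  have hden : (γ 1 0 : ℂ) * z + γ 1 1 ≠ 0 := by
    simpa [ModularGroup.denom_apply] using denom_ne_zero γ z
  have h1 : HasDerivAt (fun w : ℂ => 1 / (2 * riemannZeta 2) *
      (2 * π * Complex.I * γ 1 0 / ((γ 1 0 : ℂ) * w + γ 1 1)))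
      (1 / (2 * riemannZeta 2) * (-(2 * π * Complex.I * γ 1 0 * γ 1 0) /
        ((γ 1 0 : ℂ) * z + γ 1 1) ^ 2)) z := by
    refine HasDerivAt.const_mul _ ?_
    have := ((hasDerivAt_const (z : ℂ) (2 * π * Complex.I * γ 1 0)).div
      (((hasDerivAt_id (z : ℂ)).const_mul (γ 1 0 : ℂ)).add_const (γ 1 1 : ℂ)) hden)
    exact this.congr_deriv (by simp)
  have h2 : (SlashAction.map (2 : ℤ) γ EisensteinSeries.E2) ∘ ofComplex =ᶠ[nhds (z : ℂ)]
      fun w : ℂ => (EisensteinSeries.E2 ∘ ofComplex) w - 1 / (2 * riemannZeta 2) *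
        (2 * π * Complex.I * γ 1 0 / ((γ 1 0 : ℂ) * w + γ 1 1)) := by
    filter_upwards [isOpen_upperHalfPlaneSet.mem_nhds z.im_pos] with w hw
    rw [EisensteinSeries.E2_slash_action]
    have hd := ModularGroup.denom_apply γ ⟨w, hw⟩
    simp only [Function.comp_apply, ofComplex_apply_of_im_pos hw, EisensteinSeries.D2,
      Pi.sub_apply, Pi.smul_apply, smul_eq_mul]
    rw [hd]
  have h3 : HasDerivAt (fun w : ℂ => (EisensteinSeries.E2 ∘ ofComplex) w -
      1 / (2 * riemannZeta 2) * (2 * π * Complex.I * γ 1 0 / ((γ 1 0 : ℂ) * w + γ 1 1))) _ z :=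
    hE.hasDerivAt.sub h1
  rw [Derivative.normalizedDerivOfComplex, h2.deriv_eq, h3.deriv,
    Derivative.normalizedDerivOfComplex, ModularGroup.denom_apply]
  field_simp
  ring

theorem E2_ramanujan_slash (γ : SL(2, ℤ)) :
    SlashAction.map (4 : ℤ) γ ((12 : ℂ) • Derivative.normalizedDerivOfComplex EisensteinSeries.E2
      - EisensteinSeries.E2 ^ 2) =
    (12 : ℂ) • Derivative.normalizedDerivOfComplex EisensteinSeries.E2
      - EisensteinSeries.E2 ^ 2 := by
  have h1 := Derivative.normalizedDerivOfComplex_SL_slash (k := 2) E2_mdifferentiable (γ := γ)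
  have h2 := ModularForm.mul_slash_SL2 2 2 γ EisensteinSeries.E2 EisensteinSeries.E2
  funext z
  have h1z := congrFun h1 z
  have h2z := congrFun h2 z
  rw [normalizedDeriv_E2_slash] at h1z
  simp only [Pi.sub_apply, Pi.mul_apply] at h1z h2z
  norm_num at h1z h2z
  rw [sub_eq_add_neg, SlashAction.add_slash, SlashAction.neg_slash, ModularForm.SL_smul_slash,
    pow_two]
  simp only [Pi.add_apply, Pi.neg_apply, Pi.smul_apply, Pi.mul_apply, smul_eq_mul, h2z]
  rw [EisensteinSeries.E2_slash_action] at *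
  simp only [EisensteinSeries.D2, Pi.sub_apply, Pi.smul_apply, smul_eq_mul, riemannZeta_two] at *
  clear h1 h2 h2z
  simp only [mul_div_assoc] at *
  generalize (γ 1 0 : ℂ) / denom γ z = x at *
  generalize SlashAction.map (4 : ℤ) γ
    (Derivative.normalizedDerivOfComplex EisensteinSeries.E2) z = y at *
  have hπ : (π : ℂ) ≠ 0 := by exact_mod_cast Real.pi_ne_zero
  field_simp at h1z ⊢
  linear_combination (-6) * h1z + 36 * x ^ 2 * Complex.I_sq

theorem theta_eP : theta eP = eP ^ 2 - eQ := by
  have hq : HasQ ((12 : ℂ) • Derivative.normalizedDerivOfComplex EisensteinSeries.E2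
      - EisensteinSeries.E2 ^ 2) (theta eP - eP ^ 2) := by
    have := hasQ_Eis_two.qderiv.sub (hasQ_Eis_two.pow 2)
    convert this using 1
    rw [Eis_two]
    congr 2
    funext z
    simp [Derivative.normalizedDerivOfComplex, qderiv, hderiv_eq_deriv_comp_ofComplex]
  obtain ⟨G, hG⟩ := exists_modularForm (k := 4)
    (((Derivative.normalizedDerivOfComplex_mdifferentiable E2_mdifferentiable).const_smul
      (12 : ℂ)).sub (E2_mdifferentiable.pow 2)) E2_ramanujan_slash hq
  have hm : theta eP - eP ^ 2 ∈ MS 4 := ⟨G, hG ▸ hq⟩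
  have h0 := MS_eq_zero_of_X_pow_dvd (Submodule.add_mem _ hm eQ_mem) (n := 1) (by norm_num)
    one_pos (by
      rw [pow_one, PowerSeries.X_dvd_iff]
      have h1 := coeff_theta eP 0
      have h2 := coeff_eP 0
      have h3 := coeff_eQ 0
      simp at h1 h2 h3
      simp [h1, h2, h3])
  linear_combination h0

/-- Modular forms in the sense of `Mset` are modular forms for `𝒮ℒ`. -/
theorem mem_Mset_iff {w : ℤ} {f : ℍ → ℂ} : f ∈ Mset w ↔ ∃ F : ModularForm 𝒮ℒ w, ⇑F = f := by
  have hΓ : ((⊤ : Subgroup SL(2, ℤ)) : Subgroup (GL (Fin 2) ℝ)) = 𝒮ℒ := by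
    rw [← MonoidHom.range_eq_map]
  constructor
  · rintro ⟨F, rfl⟩
    exact ⟨ModularForm.mcast rfl F hΓ.symm, rfl⟩
  · rintro ⟨F, rfl⟩
    exact ⟨ModularForm.mcast rfl F hΓ, rfl⟩

/-- The map sending `(h_ℓ)` to `∑ E_2^ℓ h_ℓ`. -/
noncomputable def quasiMap (w : ℤ) :
    ((ℓ : Fin 5) → ModularForm 𝒮ℒ (w - 2 * (ℓ : ℕ))) →ₗ[ℂ] (ℍ → ℂ) where
  toFun h := fun z => ∑ ℓ : Fin 5, Eis 2 z ^ (ℓ : ℕ) * h ℓ z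
  map_add' h h' := by
    funext z
    simp [mul_add, Finset.sum_add_distrib]
  map_smul' c h := by
    funext z
    simp only [Pi.smul_apply, RingHom.id_apply, smul_eq_mul, Finset.mul_sum]
    refine Finset.sum_congr rfl fun ℓ _ => ?_
    exact mul_left_comm _ _ _

theorem quasiMap_apply (w : ℤ) (h : (ℓ : Fin 5) → ModularForm 𝒮ℒ (w - 2 * (ℓ : ℕ))) (z : ℍ) :
    quasiMap w h z = ∑ ℓ : Fin 5, Eis 2 z ^ (ℓ : ℕ) * h ℓ z := rfl

theorem QM_eq_range (w : ℤ) : QM w 4 = LinearMap.range (quasiMap w) := by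
  have : QMset w 4 = (LinearMap.range (quasiMap w) : Set (ℍ → ℂ)) := by
    ext f
    constructor
    · rintro ⟨h, hh, hf⟩
      choose F hF using fun ℓ : Fin 5 => mem_Mset_iff.mp (hh (ℓ : ℕ) (by omega))
      refine ⟨F, ?_⟩
      funext z
      rw [hf z, Finset.sum_range, quasiMap_apply]
      refine Finset.sum_congr rfl fun ℓ _ => ?_
      rw [← hF ℓ]
    · rintro ⟨F, rfl⟩
      refine ⟨fun ℓ => if h : ℓ < 5 then F ⟨ℓ, h⟩ else 0, fun ℓ hℓ => ?_, fun z => ?_⟩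
      · have hℓ' : ℓ < 5 := by omega
        simp only [dif_pos hℓ', mem_Mset_iff]
        exact ⟨F ⟨ℓ, hℓ'⟩, rfl⟩
      · rw [Finset.sum_range, quasiMap_apply]
        refine Finset.sum_congr rfl fun ℓ _ => ?_
        simp only [dif_pos ℓ.isLt, Fin.eta]
  rw [QM, this, Submodule.span_eq]

theorem Eis_two_smul (γ : SL(2, ℤ)) (z : ℍ) : Eis 2 (γ • z) = denom γ z ^ 2 *
    (Eis 2 z - 1 / (2 * riemannZeta 2) * EisensteinSeries.D2 γ z) := by
  have h := congrFun (EisensteinSeries.E2_slash_action γ) z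
  rw [ModularForm.SL_slash_apply] at h
  have hd : denom γ z ≠ 0 := denom_ne_zero γ z
  simp only [Pi.sub_apply, Pi.smul_apply, smul_eq_mul] at h
  rw [Eis_two, ← h]
  field_simp

theorem modularForm_smul {k : ℤ} (F : ModularForm 𝒮ℒ k) (γ : SL(2, ℤ)) (z : ℍ) :
    F (γ • z) = denom γ z ^ k * F z := by
  have h : SlashAction.map k γ (F : ℍ → ℂ) z = F z := congrFun (F.slash_action_eq' _ ⟨γ, rfl⟩) z
  rw [ModularForm.SL_slash_apply] at h
  have hd : denom γ z ≠ 0 := denom_ne_zero γ z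
  rw [← h, mul_left_comm, ← zpow_add₀ hd, add_neg_cancel, zpow_zero, mul_one]

theorem quasiMap_injective (w : ℤ) : Function.Injective (quasiMap w) := by
  rw [injective_iff_map_eq_zero]
  intro h h0
  suffices ∀ z ℓ, h ℓ z = 0 by
    funext ℓ
    ext z
    exact this z ℓ
  intro z
  let p : Polynomial ℂ := ∑ ℓ : Fin 5, Polynomial.C (h ℓ z) * Polynomial.X ^ (ℓ : ℕ)
  let x : ℤ → ℂ := fun n => Eis 2 z - 1 / (2 * riemannZeta 2) * (2 * π * Complex.I / (z + n))
  have hzn : ∀ n : ℤ, (z : ℂ) + n ≠ 0 := fun n hn => by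
    have := congrArg Complex.im hn
    simp [z.im_ne_zero] at this
  have hp : p = 0 := by
    refine Polynomial.eq_zero_of_infinite_isRoot p
      (Set.infinite_of_injective_forall_mem (f := x) ?_ ?_)
    · intro m n hmn
      have hζ : riemannZeta 2 ≠ 0 := by
        rw [riemannZeta_two]
        exact div_ne_zero (pow_ne_zero _ (by exact_mod_cast Real.pi_ne_zero)) (by norm_num)
      have hπ : (π : ℂ) ≠ 0 := by exact_mod_cast Real.pi_ne_zero
      have h1 := hzn m
      have h2 := hzn n
      simp only [x] at hmn
      field_simp at hmn
      have h3 : (π * Complex.I : ℂ) * m = π * Complex.I * n := by linear_combination hmn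
      simpa [hπ] using h3
    · intro n
      let γ : SL(2, ℤ) := ModularGroup.S * ModularGroup.T ^ n
      have hc : γ 1 0 = 1 := by
        simp [γ, Matrix.SpecialLinearGroup.coe_mul, ModularGroup.coe_S, ModularGroup.coe_T_zpow]
      have hd : γ 1 1 = n := by
        simp [γ, Matrix.SpecialLinearGroup.coe_mul, ModularGroup.coe_S, ModularGroup.coe_T_zpow]
      have hj : denom γ z = z + n := by rw [ModularGroup.denom_apply, hc, hd]; simp
      have hz : ∑ ℓ : Fin 5, Eis 2 (γ • z) ^ (ℓ : ℕ) * h ℓ (γ • z) = 0 := congrFun h0 (γ • z)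
      have hE : Eis 2 (γ • z) = (z + n) ^ 2 * x n := by
        rw [Eis_two_smul, hj, EisensteinSeries.D2, hj, hc]
        simp [x]
      have hsum : ∑ ℓ : Fin 5, Eis 2 (γ • z) ^ (ℓ : ℕ) * h ℓ (γ • z) =
          ((z : ℂ) + n) ^ w * p.eval (x n) := by
        rw [Polynomial.eval_finsetSum, Finset.mul_sum]
        refine Finset.sum_congr rfl fun ℓ _ => ?_
        rw [hE, modularForm_smul, hj, zpow_sub₀ (hzn n), zpow_mul]
        have := hzn n
        simp only [Polynomial.eval_mul, Polynomial.eval_C, Polynomial.eval_pow, Polynomial.eval_X,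
          zpow_natCast, mul_pow]
        field_simp
      rw [hz] at hsum
      exact (mul_eq_zero.mp hsum.symm).resolve_left (zpow_ne_zero _ (hzn n))
  intro ℓ
  have := congrArg (fun q => Polynomial.coeff q (ℓ : ℕ)) hp
  simpa [p, Polynomial.finsetSum_coeff, Polynomial.coeff_X_pow, Fin.val_inj] using this

theorem dimQM_eq_sum (w : ℤ) :
    dimQM w 4 = ∑ ℓ : Fin 5, Module.finrank ℂ (ModularForm 𝒮ℒ (w - 2 * (ℓ : ℕ))) := by
  rw [dimQM, QM_eq_range, LinearMap.finrank_range_of_inj (quasiMap_injective w),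
    Module.finrank_pi_fintype]

theorem finrank_level_one (k : ℕ) (hk : Even k) : Module.finrank ℂ (ModularForm 𝒮ℒ k) =
    if k % 12 = 2 then k / 12 else k / 12 + 1 := by
  rw [Module.finrank, ModularForm.dimension_level_one k hk]
  simp only [Nat.ModEq, Cardinal.toNat_natCast]
  rfl

theorem dimQM_eq (m : ℕ) (hm : 4 ≤ m) : dimQM (2 * m : ℕ) 4 =
    ∑ ℓ ∈ Finset.range 5, if (2 * (m - ℓ)) % 12 = 2 then (2 * (m - ℓ)) / 12
      else (2 * (m - ℓ)) / 12 + 1 := by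
  rw [dimQM_eq_sum, Finset.sum_range]
  refine Finset.sum_congr rfl fun ℓ _ => ?_
  rw [← finrank_level_one _ (even_two_mul _)]
  have : ((2 * m : ℕ) : ℤ) - 2 * (ℓ : ℕ) = ((2 * (m - (ℓ : ℕ)) : ℕ) : ℤ) := by omega
  rw [this]

theorem dimQM_zero_mod (k : ℕ) (hk : 0 < k) : dimQM (12 * k) 4 = 5 * k + 1 := by
  have := dimQM_eq (6 * k) (by omega)
  push_cast at this
  rw [show (12 * k : ℤ) = 2 * (6 * k) by ring, this]
  simp only [Finset.sum_range_succ, Finset.sum_range_zero]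
  split_ifs <;> omega

theorem dimQM_two_mod (k : ℕ) (hk : 0 < k) : dimQM (12 * k + 2) 4 = 5 * k + 1 := by
  have := dimQM_eq (6 * k + 1) (by omega)
  push_cast at this
  rw [show (12 * k + 2 : ℤ) = 2 * (6 * k + 1) by ring, this]
  simp only [Finset.sum_range_succ, Finset.sum_range_zero]
  split_ifs <;> omega

theorem dimQM_four_mod (k : ℕ) (hk : 0 < k) : dimQM (12 * k + 4) 4 = 5 * k + 2 := by
  have := dimQM_eq (6 * k + 2) (by omega)
  push_cast at this
  rw [show (12 * k + 4 : ℤ) = 2 * (6 * k + 2) by ring, this]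
  simp only [Finset.sum_range_succ, Finset.sum_range_zero]
  split_ifs <;> omega

theorem MS_prod {ι : Type*} (s : Finset ι) {k : ι → ℤ} {p : ι → PowerSeries ℂ}
    (h : ∀ i ∈ s, p i ∈ MS (k i)) : ∏ i ∈ s, p i ∈ MS (∑ i ∈ s, k i) := by
  classical
  induction s using Finset.induction_on with
  | empty => simpa using one_mem_MS
  | insert a s ha ih =>
    rw [Finset.prod_insert ha, Finset.sum_insert ha]
    exact MS_mul (h a (by simp)) (ih fun i hi => h i (by simp [hi])) rfl

theorem intCast_mul_mem_MS {k : ℤ} {p : PowerSeries ℂ} (hp : p ∈ MS k) (n : ℤ) :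
    (n : PowerSeries ℂ) * p ∈ MS k := by
  simpa using (MS k).smul_of_tower_mem n hp

/-- `h` is the coordinate vector of a quasimodular form of weight `w` and depth at most `4`. -/
def IsCoord (w : ℤ) (h : Fin 5 → PowerSeries ℂ) : Prop :=
  ∀ ℓ : Fin 5, h ℓ ∈ MS (w - 2 * (ℓ : ℕ))

theorem det_mem_MS {a : Fin 5 → ℤ} {v : Fin 5 → Fin 5 → PowerSeries ℂ}
    (hv : ∀ i, IsCoord (a i) (v i)) : (Matrix.of v).det ∈ MS (∑ i, a i - 20) := by
  rw [Matrix.det_apply]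
  refine Submodule.sum_mem _ fun σ _ => ?_
  rw [Units.smul_def]
  refine Submodule.smul_of_tower_mem _ _ ?_
  have h := MS_prod Finset.univ (fun i _ => hv (σ i) i)
  rwa [Finset.sum_sub_distrib, Equiv.sum_comp σ a,
    show ∑ i : Fin 5, 2 * ((i : ℕ) : ℤ) = 20 by rfl] at h

/-- The vector of Taylor coefficients in the `E_2` variable of `∑ E_2^ℓ h_ℓ`. -/
noncomputable def toG (h : Fin 5 → PowerSeries ℂ) : Fin 5 → PowerSeries ℂ :=
  ![h 0 + eP * h 1 + eP ^ 2 * h 2 + eP ^ 3 * h 3 + eP ^ 4 * h 4,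
    h 1 + 2 * eP * h 2 + 3 * eP ^ 2 * h 3 + 4 * eP ^ 3 * h 4,
    h 2 + 3 * eP * h 3 + 6 * eP ^ 2 * h 4, h 3 + 4 * eP * h 4, h 4]

theorem det_toG (v : Fin 5 → Fin 5 → PowerSeries ℂ) :
    (Matrix.of fun i => toG (v i)).det = (Matrix.of v).det := by
  let B : Matrix (Fin 5) (Fin 5) (PowerSeries ℂ) :=
    !![1, 0, 0, 0, 0; eP, 1, 0, 0, 0; eP ^ 2, 2 * eP, 1, 0, 0;
      eP ^ 3, 3 * eP ^ 2, 3 * eP, 1, 0; eP ^ 4, 4 * eP ^ 3, 6 * eP ^ 2, 4 * eP, 1]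
  have hB : B.det = 1 := by
    rw [Matrix.det_of_isLowerTriangular]
    · simp [B, Fin.prod_univ_five]
    · intro i j hij
      fin_cases i <;> fin_cases j <;> first | rfl | (exact absurd hij (by decide))
  have : (Matrix.of fun i => toG (v i)) = Matrix.of v * B := by
    ext1 i j
    rw [Matrix.mul_apply, Fin.sum_univ_five]
    fin_cases j <;> simp [toG, B] <;> ring
  rw [this, Matrix.det_mul, hB, mul_one]

/-- The derivation part of the operator induced on Taylor coefficient vectors. -/
noncomputable def opD (g : Fin 5 → PowerSeries ℂ) : Fin 5 → PowerSeries ℂ :=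
  ![theta (g 0), theta (g 1) + 4 * g 0, theta (g 2) + 3 * g 1, theta (g 3) + 2 * g 2,
    theta (g 4) + g 3]

/-- The scaled Serre derivative on Taylor coefficient vectors. -/
noncomputable def opT (n : ℤ) (g : Fin 5 → PowerSeries ℂ) : Fin 5 → PowerSeries ℂ :=
  opD g - ((n : PowerSeries ℂ) * eP) • g

/-- The scaled Serre derivative `12 ∂_{w-4}` on coordinate vectors of weight `w`. -/
noncomputable def opS (w : ℤ) (h : Fin 5 → PowerSeries ℂ) : Fin 5 → PowerSeries ℂ :=
  ![theta (h 0) - ((w : ℤ) : PowerSeries ℂ) * eP * h 0 - eQ * h 1,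
    theta (h 1) - ((w - 2 : ℤ) : PowerSeries ℂ) * eP * h 1 + 4 * h 0 - 2 * (eQ * h 2),
    theta (h 2) - ((w - 4 : ℤ) : PowerSeries ℂ) * eP * h 2 + 3 * h 1 - 3 * (eQ * h 3),
    theta (h 3) - ((w - 6 : ℤ) : PowerSeries ℂ) * eP * h 3 + 2 * h 2 - 4 * (eQ * h 4),
    theta (h 4) - ((w - 8 : ℤ) : PowerSeries ℂ) * eP * h 4 + h 3]

theorem ofNat_mul_mem_MS {k : ℤ} {p : PowerSeries ℂ} (hp : p ∈ MS k) (n : ℕ) [n.AtLeastTwo] :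
    (OfNat.ofNat n : PowerSeries ℂ) * p ∈ MS k := by
  simpa using intCast_mul_mem_MS hp (OfNat.ofNat n)

theorem IsCoord.opS {w : ℤ} {h : Fin 5 → PowerSeries ℂ} (hh : IsCoord w h) :
    IsCoord (w + 2) (opS w h) := by
  have h0 : h 0 ∈ MS w := by simpa using hh 0
  have h1 : h 1 ∈ MS (w - 2) := by simpa using hh 1
  have h2 : h 2 ∈ MS (w - 4) := by simpa using hh 2
  have h3 : h 3 ∈ MS (w - 6) := by simpa using hh 3
  have h4 : h 4 ∈ MS (w - 8) := by simpa using hh 4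
  intro ℓ
  fin_cases ℓ
  · simpa [_root_.opS] using (MS (w + 2)).sub_mem (theta_sub_mem_MS h0 (c := w + 2) (by ring))
      (MS_mul eQ_mem h1 (by ring))
  · have := (MS w).sub_mem ((MS w).add_mem (theta_sub_mem_MS h1 (by ring))
      (ofNat_mul_mem_MS h0 4)) (ofNat_mul_mem_MS (MS_mul eQ_mem h2 (c := w) (by ring)) 2)
    simpa [_root_.opS] using this
  · have := (MS (w - 2)).sub_mem ((MS (w - 2)).add_mem (theta_sub_mem_MS h2 (by ring))
      (ofNat_mul_mem_MS h1 3)) (ofNat_mul_mem_MS (MS_mul eQ_mem h3 (c := w - 2) (by ring)) 3)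
    have e : w + 2 - 4 = w - 2 := by ring
    simpa [_root_.opS, e] using this
  · have := (MS (w - 4)).sub_mem ((MS (w - 4)).add_mem (theta_sub_mem_MS h3 (by ring))
      (ofNat_mul_mem_MS h2 2)) (ofNat_mul_mem_MS (MS_mul eQ_mem h4 (c := w - 4) (by ring)) 4)
    have e : w + 2 - 6 = w - 4 := by ring
    simpa [_root_.opS, e] using this
  · have := (MS (w - 6)).add_mem (theta_sub_mem_MS h4 (c := w - 6) (by ring)) h3
    have e : w + 2 - 8 = w - 6 := by ring
    simpa [_root_.opS, e] using this

theorem toG_opS (w : ℤ) (h : Fin 5 → PowerSeries ℂ) :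
    toG (opS w h) = opT (w - 4) (toG h) := by
  have hn : ∀ n : ℕ, theta (n : PowerSeries ℂ) = 0 := fun n => Derivation.map_natCast theta n
  have h2 : theta 2 = 0 := mod_cast hn 2
  have h3 : theta 3 = 0 := mod_cast hn 3
  have h4 : theta 4 = 0 := mod_cast hn 4
  have h6 : theta 6 = 0 := mod_cast hn 6
  funext i
  fin_cases i <;>
  · simp [toG, opS, opT, opD, Derivation.leibniz, Derivation.leibniz_pow, theta_eP, h2, h3, h4, h6]
    ring

theorem theta_X_pow_mul (n : ℕ) (p : PowerSeries ℂ) :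
    theta (PowerSeries.X ^ n * p) =
      PowerSeries.X ^ n * (theta p + (12 * n : PowerSeries ℂ) * p) := by
  have hX : theta (PowerSeries.X ^ n) = 12 * (n : PowerSeries ℂ) * PowerSeries.X ^ n := by
    ext m
    rw [coeff_theta, show (12 * (n : PowerSeries ℂ)) = PowerSeries.C (12 * (n : ℂ)) by
      rw [map_mul, map_natCast, map_ofNat],
      PowerSeries.coeff_C_mul, PowerSeries.coeff_X_pow]
    split_ifs with h <;> simp [h]
  rw [Derivation.leibniz, hX]
  simp only [smul_eq_mul]
  ring

theorem constantCoeff_theta (p : PowerSeries ℂ) : PowerSeries.constantCoeff (theta p) = 0 := by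
  rw [← PowerSeries.coeff_zero_eq_constantCoeff_apply, coeff_theta]
  simp

theorem exists_eq_X_pow_mul {p : PowerSeries ℂ} (hp : p ≠ 0) :
    ∃ n : ℕ, ∃ b : PowerSeries ℂ,
      p = PowerSeries.X ^ n * b ∧ PowerSeries.constantCoeff b ≠ 0 := by
  obtain ⟨b, hb⟩ := PowerSeries.X_pow_order_dvd (φ := p)
  refine ⟨_, b, hb, fun h0 => PowerSeries.coeff_order hp ?_⟩
  obtain ⟨d, rfl⟩ := PowerSeries.X_dvd_iff.mpr h0
  refine PowerSeries.X_pow_dvd_iff.mp ⟨d, ?_⟩ _ (Nat.lt_succ_self _)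
  rw [pow_succ, mul_assoc]
  exact hb

theorem mul_theta_sub_ne_zero {a : PowerSeries ℂ} (ha : a ≠ 0) (u : PowerSeries ℂ) {r : ℕ}
    (hr : r ≠ 0) : a * (theta u + (r : PowerSeries ℂ) * a) - theta a * u ≠ 0 := by
  obtain ⟨n, b, rfl, hb⟩ := exists_eq_X_pow_mul ha
  by_cases hdvd : PowerSeries.X ^ n ∣ u
  · obtain ⟨v, rfl⟩ := hdvd
    intro h
    have h2 : PowerSeries.X ^ (2 * n) *
        (b * (theta v + (r : PowerSeries ℂ) * b) - theta b * v) = 0 := by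
      rw [← h, theta_X_pow_mul, theta_X_pow_mul]
      ring
    have h3 := congrArg PowerSeries.constantCoeff
      ((mul_eq_zero.mp h2).resolve_left (pow_ne_zero _ PowerSeries.X_ne_zero))
    simp [constantCoeff_theta, hr, hb] at h3
  · have hu : u ≠ 0 := by
      rintro rfl
      exact hdvd (dvd_zero _)
    obtain ⟨j, v, rfl, hv⟩ := exists_eq_X_pow_mul hu
    have hj : j < n := by
      by_contra! hj
      exact hdvd ((pow_dvd_pow _ hj).mul_right v)
    obtain ⟨m, rfl⟩ := Nat.exists_eq_add_of_lt hj
    intro h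
    have h2 : PowerSeries.X ^ (2 * j + (m + 1)) *
        (b * (theta v + (r : PowerSeries ℂ) * (PowerSeries.X ^ (m + 1) * b)) -
          (theta b + (12 * (m + 1) : PowerSeries ℂ) * b) * v) = 0 := by
      rw [← h, theta_X_pow_mul, theta_X_pow_mul]
      push_cast
      ring
    have h3 := congrArg PowerSeries.constantCoeff
      ((mul_eq_zero.mp h2).resolve_left (pow_ne_zero _ PowerSeries.X_ne_zero))
    have hm : (m : ℂ) + 1 ≠ 0 := by exact_mod_cast Nat.succ_ne_zero m
    simp [constantCoeff_theta, hb, hv, hm, map_ofNat] at h3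

theorem opD_add (u v : Fin 5 → PowerSeries ℂ) : opD (u + v) = opD u + opD v := by
  funext i
  fin_cases i <;> simp [opD] <;> ring

theorem opD_smul (a : PowerSeries ℂ) (v : Fin 5 → PowerSeries ℂ) :
    opD (a • v) = theta a • v + a • opD v := by
  funext i
  fin_cases i <;> simp [opD, Derivation.leibniz] <;> ring

/-- The span of the first `i + 1` terms of a sequence of vectors. -/
noncomputable def prefixSpan (g : ℕ → Fin 5 → PowerSeries ℂ) (i : ℕ) :
    Submodule (PowerSeries ℂ) (Fin 5 → PowerSeries ℂ) :=
  Submodule.span _ (g '' Set.Iic i)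

theorem prefixSpan_mono (g : ℕ → Fin 5 → PowerSeries ℂ) {i j : ℕ} (h : i ≤ j) :
    prefixSpan g i ≤ prefixSpan g j :=
  Submodule.span_mono (Set.image_mono (Set.Iic_subset_Iic.mpr h))

theorem mem_prefixSpan (g : ℕ → Fin 5 → PowerSeries ℂ) {i j : ℕ} (h : i ≤ j) :
    g i ∈ prefixSpan g j :=
  Submodule.subset_span ⟨i, h, rfl⟩

theorem opD_mem_prefixSpan {g : ℕ → Fin 5 → PowerSeries ℂ} {n : ℕ → PowerSeries ℂ}
    (hg : ∀ j, g (j + 1) = opD (g j) - n j • g j) {i : ℕ} {v : Fin 5 → PowerSeries ℂ}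
    (hv : v ∈ prefixSpan g i) : opD v ∈ prefixSpan g (i + 1) := by
  induction hv using Submodule.span_induction with
  | mem x hx =>
    obtain ⟨j, hj, rfl⟩ := hx
    have hj' : j ≤ i := hj
    rw [show opD (g j) = g (j + 1) + n j • g j by rw [hg]; abel]
    exact Submodule.add_mem _ (mem_prefixSpan g (by omega))
      (Submodule.smul_mem _ _ (mem_prefixSpan g (by omega)))
  | zero =>
    have : opD 0 = 0 := by
      have := opD_smul 0 0
      simpa using this
    rw [this]
    exact Submodule.zero_mem _
  | add x y _ _ hx hy => rw [opD_add]; exact Submodule.add_mem _ hx hy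
  | smul a x hx hx' =>
    rw [opD_smul]
    exact Submodule.add_mem _
      (Submodule.smul_mem _ _ (prefixSpan_mono g (Nat.le_succ i) hx))
      (Submodule.smul_mem _ _ hx')

theorem wronskian_ne_zero {g : ℕ → Fin 5 → PowerSeries ℂ} {n : ℕ → PowerSeries ℂ}
    (hg : ∀ j, g (j + 1) = opD (g j) - n j • g j) (h0 : g 0 0 ≠ 0) :
    (Matrix.of fun i : Fin 5 => g i).det ≠ 0 := by
  intro hdet
  obtain ⟨c, hc, hMc⟩ := Matrix.exists_mulVec_eq_zero_iff.mpr hdet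
  have step : ∀ {i : ℕ} {v : Fin 5 → PowerSeries ℂ} (a : PowerSeries ℂ), v ∈ prefixSpan g i →
      a • opD v - theta a • v ∈ prefixSpan g (i + 1) := fun a hv =>
    Submodule.sub_mem _ (Submodule.smul_mem _ _ (opD_mem_prefixSpan hg hv))
      (Submodule.smul_mem _ _ (prefixSpan_mono g (Nat.le_succ _) hv))
  have kill : ∀ v ∈ prefixSpan g 4, ∑ m, v m * c m = 0 := by
    intro v hv
    induction hv using Submodule.span_induction with
    | mem x hx =>
      obtain ⟨j, hj, rfl⟩ := hx
      exact congrFun hMc ⟨j, Nat.lt_succ_of_le hj⟩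
    | zero => simp
    | add x y _ _ hx hy => simp [add_mul, Finset.sum_add_distrib, hx, hy]
    | smul a x _ hx => simp [mul_assoc, ← Finset.mul_sum, hx]
  have hv0 := mem_prefixSpan g (le_refl 0)
  obtain ⟨v1, hv1, h10, h11⟩ : ∃ v ∈ prefixSpan g 1, v 0 = 0 ∧ v 1 ≠ 0 := by
    refine ⟨_, step (g 0 0) hv0, ?_, ?_⟩
    · simp [opD]; ring
    · simpa [opD] using mul_theta_sub_ne_zero h0 (g 0 1) (r := 4) (by norm_num)
  obtain ⟨v2, hv2, h20, h21, h22⟩ : ∃ v ∈ prefixSpan g 2, v 0 = 0 ∧ v 1 = 0 ∧ v 2 ≠ 0 := by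
    refine ⟨_, step (v1 1) hv1, ?_, ?_, ?_⟩
    · simp [opD, h10]
    · simp [opD, h10]; ring
    · simpa [opD] using mul_theta_sub_ne_zero h11 (v1 2) (r := 3) (by norm_num)
  obtain ⟨v3, hv3, h30, h31, h32, h33⟩ :
      ∃ v ∈ prefixSpan g 3, v 0 = 0 ∧ v 1 = 0 ∧ v 2 = 0 ∧ v 3 ≠ 0 := by
    refine ⟨_, step (v2 2) hv2, ?_, ?_, ?_, ?_⟩
    · simp [opD, h20]
    · simp [opD, h20, h21]
    · simp [opD, h21]; ring
    · simpa [opD] using mul_theta_sub_ne_zero h22 (v2 3) (r := 2) (by norm_num)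
  obtain ⟨v4, hv4, h40, h41, h42, h43, h44⟩ :
      ∃ v ∈ prefixSpan g 4, v 0 = 0 ∧ v 1 = 0 ∧ v 2 = 0 ∧ v 3 = 0 ∧ v 4 ≠ 0 := by
    refine ⟨_, step (v3 3) hv3, ?_, ?_, ?_, ?_, ?_⟩
    · simp [opD, h30]
    · simp [opD, h30, h31]
    · simp [opD, h31, h32]
    · simp [opD, h32]; ring
    · simpa [opD] using mul_theta_sub_ne_zero h33 (v3 4) (r := 1) (by norm_num)
  have c4 : c 4 = 0 := by
    simpa [Fin.sum_univ_five, h40, h41, h42, h43, h44] using kill v4 hv4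
  have c3 : c 3 = 0 := by
    simpa [Fin.sum_univ_five, h30, h31, h32, h33, c4] using
      kill v3 (prefixSpan_mono g (by norm_num) hv3)
  have c2 : c 2 = 0 := by
    simpa [Fin.sum_univ_five, h20, h21, h22, c3, c4] using
      kill v2 (prefixSpan_mono g (by norm_num) hv2)
  have c1 : c 1 = 0 := by
    simpa [Fin.sum_univ_five, h10, h11, c2, c3, c4] using
      kill v1 (prefixSpan_mono g (by norm_num) hv1)
  have c0 : c 0 = 0 := by
    simpa [Fin.sum_univ_five, h0, c1, c2, c3, c4] using
      kill (g 0) (prefixSpan_mono g (by norm_num) hv0)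
  refine hc (funext fun m => ?_)
  fin_cases m <;> assumption

theorem toG_add (u v : Fin 5 → PowerSeries ℂ) : toG (u + v) = toG u + toG v := by
  funext i
  fin_cases i <;> simp [toG] <;> ring

theorem toG_smul (a : PowerSeries ℂ) (v : Fin 5 → PowerSeries ℂ) :
    toG (a • v) = a • toG v := by
  funext i
  fin_cases i <;> simp [toG] <;> ring

/-- The iterated scaled Serre derivatives of a coordinate vector of weight `w`. -/
noncomputable def serreRow (w : ℤ) (h : Fin 5 → PowerSeries ℂ) : ℕ → Fin 5 → PowerSeries ℂ
  | 0 => h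
  | j + 1 => opS (w + 2 * j) (serreRow w h j)

theorem IsCoord.serreRow {w : ℤ} {h : Fin 5 → PowerSeries ℂ} (hh : IsCoord w h) :
    ∀ j : ℕ, IsCoord (w + 2 * j) (serreRow w h j)
  | 0 => by simpa [_root_.serreRow] using hh
  | j + 1 => by
    have := (hh.serreRow j).opS
    rw [_root_.serreRow]
    convert this using 1
    push_cast
    ring

theorem toG_serreRow_succ (w : ℤ) (h : Fin 5 → PowerSeries ℂ) (j : ℕ) :
    toG (serreRow w h (j + 1)) = opD (toG (serreRow w h j)) -
      (((w - 4 + 2 * j : ℤ) : PowerSeries ℂ) * eP) • toG (serreRow w h j) := by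
  rw [serreRow, toG_opS, opT, show w + 2 * (j : ℤ) - 4 = w - 4 + 2 * j by ring]

theorem toG_serreRow_succ_zero (w : ℤ) (h : Fin 5 → PowerSeries ℂ) (j : ℕ) :
    toG (serreRow w h (j + 1)) 0 = theta (toG (serreRow w h j) 0) -
      ((w - 4 + 2 * j : ℤ) : PowerSeries ℂ) * eP * toG (serreRow w h j) 0 := by
  rw [toG_serreRow_succ]
  simp [opD]

theorem dvd_det_of_dvd_column {a : PowerSeries ℂ} {M : Matrix (Fin 5) (Fin 5) (PowerSeries ℂ)}
    (h : ∀ i, a ∣ M i 0) : a ∣ M.det := by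
  rw [Matrix.det_succ_column_zero]
  exact Finset.dvd_sum fun i _ => ((h i).mul_left _).mul_right _

/-- The iterated scaled Serre derivatives of `q^ν u`, divided by `q^ν`. -/
noncomputable def serreFactor (w : ℤ) (ν : ℕ) (u : PowerSeries ℂ) : ℕ → PowerSeries ℂ
  | 0 => u
  | j + 1 => theta (serreFactor w ν u j) + 12 * (ν : PowerSeries ℂ) * serreFactor w ν u j -
      ((w - 4 + 2 * j : ℤ) : PowerSeries ℂ) * eP * serreFactor w ν u j

theorem toG_serreRow_zero {w : ℤ} {h : Fin 5 → PowerSeries ℂ} {ν : ℕ} {u : PowerSeries ℂ}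
    (hu : toG h 0 = PowerSeries.X ^ ν * u) :
    ∀ j, toG (serreRow w h j) 0 = PowerSeries.X ^ ν * serreFactor w ν u j
  | 0 => by simpa [serreRow, serreFactor] using hu
  | j + 1 => by
    rw [toG_serreRow_succ_zero, toG_serreRow_zero hu j, theta_X_pow_mul, serreFactor]
    ring

/-- A quasimodular form of weight `w` and depth at most `4` vanishing to an order larger than
`5w/12` is zero. -/
theorem IsCoord.toG_eq_zero {w : ℤ} {h : Fin 5 → PowerSeries ℂ} (hh : IsCoord w h) {N : ℕ}
    (hN : 0 < N) (hw : 5 * w < 12 * N) (hdvd : PowerSeries.X ^ N ∣ toG h 0) : toG h 0 = 0 := by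
  by_contra hne
  refine wronskian_ne_zero (g := fun j => toG (_root_.serreRow w h j))
    (toG_serreRow_succ w h) hne ?_
  obtain ⟨u, hu⟩ := hdvd
  have hmem := det_mem_MS fun i : Fin 5 => hh.serreRow i
  rw [← det_toG] at hmem
  refine MS_eq_zero_of_X_pow_dvd hmem ?_ hN
    (dvd_det_of_dvd_column fun i => ⟨_, toG_serreRow_zero hu i⟩)
  simp only [Fin.sum_univ_five]
  norm_num
  linarith

/-- The combination of iterated Serre derivatives annihilating extremal forms. -/
noncomputable def odeComb {M : Type*} [AddCommGroup M] [Module (PowerSeries ℂ) M] (w : ℤ)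
    (v : ℕ → M) : M :=
  v 5 + (((20 - 10 * w ^ 2 : ℤ) : PowerSeries ℂ) * eQ) • v 3 +
    (((-20 * w ^ 3 + 60 * w ^ 2 - 120 : ℤ) : PowerSeries ℂ) * eR) • v 2 +
    (((-(2 * w + 1) * (w - 2) ^ 4 + 2 * (w + 1) * (w - 4) ^ 4 : ℤ) : PowerSeries ℂ) *
      eQ ^ 2) • v 1 +
    (((-4 * (w + 1) * (w - 4) ^ 4 : ℤ) : PowerSeries ℂ) * (eQ * eR)) • v 0

theorem IsCoord.add {w : ℤ} {u v : Fin 5 → PowerSeries ℂ} (hu : IsCoord w u)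
    (hv : IsCoord w v) : IsCoord w (u + v) := fun ℓ => (MS _).add_mem (hu ℓ) (hv ℓ)

theorem IsCoord.smul {k w c : ℤ} {p : PowerSeries ℂ} {v : Fin 5 → PowerSeries ℂ} (hp : p ∈ MS k)
    (hv : IsCoord w v) (h : k + w = c) : IsCoord c (p • v) := fun ℓ =>
  MS_mul hp (hv ℓ) (by linarith)

theorem IsCoord.odeComb {w : ℤ} {h : Fin 5 → PowerSeries ℂ} (hh : IsCoord w h) :
    IsCoord (w + 10) (_root_.odeComb w (_root_.serreRow w h)) := by
  have h4 := fun n => intCast_mul_mem_MS eQ_mem n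
  have h6 := fun n => intCast_mul_mem_MS eR_mem n
  have h8 := fun n => intCast_mul_mem_MS (MS_mul eQ_mem eQ_mem (c := 8) (by norm_num)) n
  have h10 := fun n => intCast_mul_mem_MS (MS_mul eQ_mem eR_mem (c := 10) (by norm_num)) n
  rw [← pow_two] at h8
  refine IsCoord.add (IsCoord.add (IsCoord.add (IsCoord.add ?_ ?_) ?_) ?_) ?_
  · exact hh.serreRow 5
  · exact IsCoord.smul (h4 _) (hh.serreRow 3) (by push_cast; ring)
  · exact IsCoord.smul (h6 _) (hh.serreRow 2) (by push_cast; ring)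
  · exact IsCoord.smul (h8 _) (hh.serreRow 1) (by push_cast; ring)
  · exact IsCoord.smul (h10 _) (hh.serreRow 0) (by push_cast; ring)

theorem toG_odeComb (w : ℤ) (v : ℕ → Fin 5 → PowerSeries ℂ) :
    toG (odeComb w v) = odeComb w fun j => toG (v j) := by
  simp only [odeComb, toG_add, toG_smul]

theorem constantCoeff_eP : PowerSeries.constantCoeff eP = 1 := by
  rw [← PowerSeries.coeff_zero_eq_constantCoeff_apply, coeff_eP, if_pos rfl]

theorem constantCoeff_eQ : PowerSeries.constantCoeff eQ = 1 := by
  rw [← PowerSeries.coeff_zero_eq_constantCoeff_apply, coeff_eQ, if_pos rfl]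

theorem constantCoeff_eR : PowerSeries.constantCoeff eR = 1 := by
  rw [← PowerSeries.coeff_zero_eq_constantCoeff_apply, coeff_eR, if_pos rfl]

theorem constantCoeff_odeComb_serreFactor {w : ℤ} {ν : ℕ} (hν : 12 * (ν : ℤ) = 5 * w)
    (u : PowerSeries ℂ) :
    PowerSeries.constantCoeff (odeComb w (serreFactor w ν u)) = 0 := by
  have hν' : 12 * (ν : ℂ) = 5 * w := by exact_mod_cast hν
  simp only [odeComb, serreFactor, map_add, map_sub, map_mul, map_pow, smul_eq_mul,
    map_intCast, map_natCast, map_ofNat, constantCoeff_theta, constantCoeff_eP,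
    constantCoeff_eQ, constantCoeff_eR, hν']
  push_cast
  ring

theorem constantCoeff_odeComb_serreRow {w : ℤ} {h : Fin 5 → PowerSeries ℂ} {ν : ℕ}
    {u : PowerSeries ℂ} (hν : 0 < ν) (hu : toG h 0 = PowerSeries.X ^ ν * u) (m : Fin 5) :
    PowerSeries.constantCoeff (odeComb w (fun j => toG (serreRow w h j)) m) = 0 := by
  have h0 : ∀ j, PowerSeries.constantCoeff (toG (serreRow w h j) 0) = 0 := fun j => by
    simp [toG_serreRow_zero hu j, hν.ne']
  have hcomb : PowerSeries.constantCoeff (odeComb w (fun j => toG (serreRow w h j)) m) =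
      PowerSeries.constantCoeff (odeComb w (fun j => toG (serreRow w h j) m)) := rfl
  rw [hcomb]
  have h1 : ∀ j, PowerSeries.constantCoeff (toG (serreRow w h (j + 1)) 1) =
      -(w - 4 + 2 * j) * PowerSeries.constantCoeff (toG (serreRow w h j) 1) := fun j => by
    rw [toG_serreRow_succ]
    simp [opD, constantCoeff_theta, constantCoeff_eP, h0, map_ofNat]
    ring
  have h2 : ∀ j, PowerSeries.constantCoeff (toG (serreRow w h (j + 1)) 2) =
      -(w - 4 + 2 * j) * PowerSeries.constantCoeff (toG (serreRow w h j) 2) +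
      3 * PowerSeries.constantCoeff (toG (serreRow w h j) 1) := fun j => by
    rw [toG_serreRow_succ]
    simp [opD, constantCoeff_theta, constantCoeff_eP, map_ofNat]
    ring
  have h3 : ∀ j, PowerSeries.constantCoeff (toG (serreRow w h (j + 1)) 3) =
      -(w - 4 + 2 * j) * PowerSeries.constantCoeff (toG (serreRow w h j) 3) +
      2 * PowerSeries.constantCoeff (toG (serreRow w h j) 2) := fun j => by
    rw [toG_serreRow_succ]
    simp [opD, constantCoeff_theta, constantCoeff_eP, map_ofNat]
    ring
  have h4 : ∀ j, PowerSeries.constantCoeff (toG (serreRow w h (j + 1)) 4) =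
      -(w - 4 + 2 * j) * PowerSeries.constantCoeff (toG (serreRow w h j) 4) +
      PowerSeries.constantCoeff (toG (serreRow w h j) 3) := fun j => by
    rw [toG_serreRow_succ]
    simp [opD, constantCoeff_theta, constantCoeff_eP, map_ofNat]
    ring
  have e : ∀ v : ℕ → PowerSeries ℂ, PowerSeries.constantCoeff (odeComb w v) =
      PowerSeries.constantCoeff (v (4 + 1)) +
      (20 - 10 * w ^ 2) * PowerSeries.constantCoeff (v (2 + 1)) +
      (-20 * w ^ 3 + 60 * w ^ 2 - 120) * PowerSeries.constantCoeff (v (1 + 1)) +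
      (-(2 * w + 1) * (w - 2) ^ 4 + 2 * (w + 1) * (w - 4) ^ 4) *
        PowerSeries.constantCoeff (v (0 + 1)) +
      (-4 * (w + 1) * (w - 4) ^ 4) * PowerSeries.constantCoeff (v 0) := fun v => by
    simp only [odeComb, map_add, map_mul, map_pow, smul_eq_mul, map_intCast,
      constantCoeff_eQ, constantCoeff_eR]
    push_cast
    ring
  rw [e]
  fin_cases m
  · simp [h0]
  · simp [h1]
    ring
  · simp [h1, h2]
    ring
  · simp [h1, h2, h3]
    ring
  · simp [h1, h2, h3, h4]
    ring

/-- Extremal forms of weight `w ≡ 0 mod 12` satisfy a fifth order differential equation. -/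
theorem IsCoord.odeComb_serreFactor_eq_zero {w : ℤ} {h : Fin 5 → PowerSeries ℂ}
    (hh : IsCoord w h) {ν : ℕ} (hν : 0 < ν) (hw : 12 * (ν : ℤ) = 5 * w) {u : PowerSeries ℂ}
    (hu : toG h 0 = PowerSeries.X ^ ν * u) (hne : u ≠ 0) :
    _root_.odeComb w (serreFactor w ν u) = 0 := by
  set r := _root_.odeComb w (_root_.serreRow w h) with hr
  set M : Matrix (Fin 5) (Fin 5) (PowerSeries ℂ) :=
    Matrix.of fun i : Fin 5 => toG (_root_.serreRow w h i) with hM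
  have hdet : M.det ≠ 0 := by
    refine wronskian_ne_zero (g := fun j => toG (_root_.serreRow w h j))
      (toG_serreRow_succ w h) ?_
    change toG h 0 ≠ 0
    rw [hu]
    exact mul_ne_zero (pow_ne_zero _ PowerSeries.X_ne_zero) hne
  have hr0 : toG r 0 = PowerSeries.X ^ ν * _root_.odeComb w (serreFactor w ν u) := by
    rw [hr, toG_odeComb]
    simp only [_root_.odeComb, Pi.add_apply, Pi.smul_apply, smul_eq_mul,
      toG_serreRow_zero hu]
    ring
  obtain ⟨t, ht⟩ := PowerSeries.X_dvd_iff.mpr (constantCoeff_odeComb_serreFactor hw u)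
  have hX : ∀ m, ∃ s, toG r m = PowerSeries.X * s := fun m => by
    refine PowerSeries.X_dvd_iff.mpr ?_
    rw [hr, toG_odeComb]
    exact constantCoeff_odeComb_serreRow hν hu m
  choose s hs using hX
  have hs0 : s 0 = PowerSeries.X ^ ν * t := by
    have : PowerSeries.X * s 0 = PowerSeries.X * (PowerSeries.X ^ ν * t) := by
      rw [← hs, hr0, ht]
      ring
    exact mul_left_cancel₀ PowerSeries.X_ne_zero this
  have hcramer : ∀ i, (M.updateRow i (toG r)).det = 0 := by
    intro i
    have hmem := det_mem_MS (a := Function.update (fun j : Fin 5 => w + 2 * ((j : ℕ) : ℤ)) i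
      (w + 10)) (v := Function.update (fun j : Fin 5 => _root_.serreRow w h j) i r) (by
        intro j
        by_cases hj : j = i
        · subst hj
          simpa using hh.odeComb
        · simpa [hj] using hh.serreRow j)
    rw [← det_toG] at hmem
    have hupd : (Matrix.of fun j => toG (Function.update
        (fun j : Fin 5 => _root_.serreRow w h j) i r j)) = M.updateRow i (toG r) := by
      ext1 j m
      by_cases hj : j = i
      · subst hj
        simp
      · simp [hj, hM]
    rw [hupd] at hmem
    refine MS_eq_zero_of_X_pow_dvd hmem (n := ν + 1) ?_ (Nat.succ_pos _) ?_
    · push_cast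
      fin_cases i <;> simp [Fin.sum_univ_five, Function.update_apply] <;> linarith
    · have : toG r = (PowerSeries.X : PowerSeries ℂ) • s := funext hs
      rw [this, Matrix.det_updateRow_smul, pow_succ']
      refine mul_dvd_mul_left _ (dvd_det_of_dvd_column fun j => ?_)
      by_cases hj : j = i
      · subst hj
        simp [hs0]
      · simp [hj, hM, toG_serreRow_zero hu]
  have hz : toG r = 0 := by
    have h1 := Matrix.mulVec_cramer M.transpose (toG r)
    have h2 : Matrix.cramer M.transpose (toG r) = 0 := funext fun i => by
      rw [Matrix.cramer_transpose_apply, hcramer, Pi.zero_apply]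
    rw [h2, Matrix.mulVec_zero, Matrix.det_transpose] at h1
    exact (smul_eq_zero.mp h1.symm).resolve_left hdet
  rw [hz] at hr0
  exact (mul_eq_zero.mp hr0.symm).resolve_left (pow_ne_zero _ PowerSeries.X_ne_zero)

theorem coeff_one_theta (p : PowerSeries ℂ) :
    PowerSeries.coeff 1 (theta p) = 12 * PowerSeries.coeff 1 p := by
  rw [coeff_theta]
  simp

theorem coeff_one_eP : PowerSeries.coeff 1 eP = -24 := by
  simp [coeff_eP]

theorem coeff_one_eQ : PowerSeries.coeff 1 eQ = 240 := by
  simp [coeff_eQ]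

theorem coeff_one_eR : PowerSeries.coeff 1 eR = -504 := by
  simp [coeff_eR]

theorem coeff_one_intCast (n : ℤ) : PowerSeries.coeff 1 (n : PowerSeries ℂ) = 0 := by
  rw [← map_intCast (PowerSeries.C (R := ℂ)), PowerSeries.coeff_C]
  simp

theorem constantCoeff_serreFactor_succ {w : ℤ} {ν : ℕ} (hν : 12 * (ν : ℤ) = 5 * w)
    (u : PowerSeries ℂ) (j : ℕ) : PowerSeries.constantCoeff (serreFactor w ν u (j + 1)) =
      (4 * w + 4 - 2 * j) * PowerSeries.constantCoeff (serreFactor w ν u j) := by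
  have hν' : 12 * (ν : ℂ) = 5 * w := by exact_mod_cast hν
  simp only [serreFactor, map_add, map_sub, map_mul, map_intCast, map_natCast, map_ofNat,
    constantCoeff_theta, constantCoeff_eP, hν']
  push_cast
  ring

theorem coeff_one_serreFactor_succ {w : ℤ} {ν : ℕ} (hν : 12 * (ν : ℤ) = 5 * w)
    (u : PowerSeries ℂ) (j : ℕ) : PowerSeries.coeff 1 (serreFactor w ν u (j + 1)) =
      (4 * w + 16 - 2 * j) * PowerSeries.coeff 1 (serreFactor w ν u j) +
      24 * (w - 4 + 2 * j) * PowerSeries.constantCoeff (serreFactor w ν u j) := by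
  have hν' : 12 * (ν : PowerSeries ℂ) = ((5 * w : ℤ) : PowerSeries ℂ) := by
    rw [← hν]
    push_cast
    rfl
  rw [serreFactor, hν']
  simp only [map_add, map_sub, PowerSeries.coeff_one_mul, map_mul, map_intCast,
    constantCoeff_eP, coeff_one_eP, coeff_one_theta, coeff_one_intCast]
  push_cast
  ring

/-- The first two coefficients of the combination of derivatives in the second recursion. -/
theorem coeff_one_of_odeComb_eq_zero {w : ℤ} {ν : ℕ} (hν : 12 * (ν : ℤ) = 5 * w)
    {u : PowerSeries ℂ} (hu : PowerSeries.constantCoeff u = 1)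
    (h : odeComb w (serreFactor w ν u) = 0) :
    (5 * (w : ℂ) + 12) ^ 4 * ((w + 1) * (2 * w + 1) / 18 * (PowerSeries.coeff 1 u + 240) -
      PowerSeries.coeff 1 (serreFactor w ν u 2) / 144) =
      2 ^ 6 * 3 ^ 5 * (w + 1) * (w + 2) ^ 5 := by
  have hb := constantCoeff_serreFactor_succ hν u
  have hc := coeff_one_serreFactor_succ hν u
  have hb0 : PowerSeries.constantCoeff (serreFactor w ν u 0) = 1 := hu
  have hc0 : PowerSeries.coeff 1 (serreFactor w ν u 0) = PowerSeries.coeff 1 u := rfl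
  have h1 := congrArg (PowerSeries.coeff 1) h
  simp only [odeComb, map_add, smul_eq_mul, PowerSeries.coeff_one_mul, map_mul, map_intCast,
    constantCoeff_eQ, constantCoeff_eR, coeff_one_eQ, coeff_one_eR, coeff_one_intCast, hb, hc,
    hb0, hc0, map_zero, pow_two eQ] at h1 ⊢
  push_cast at h1 ⊢
  linear_combination (-(12 * (w : ℂ) + 27) / 216) * h1

/-- The first six coefficients of a power series. -/
def HasTrunc (p : PowerSeries ℂ) (a₀ a₁ a₂ a₃ a₄ a₅ : ℂ) : Prop :=
  PowerSeries.coeff 0 p = a₀ ∧ PowerSeries.coeff 1 p = a₁ ∧ PowerSeries.coeff 2 p = a₂ ∧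
    PowerSeries.coeff 3 p = a₃ ∧ PowerSeries.coeff 4 p = a₄ ∧ PowerSeries.coeff 5 p = a₅

theorem HasTrunc.mul {p r : PowerSeries ℂ} {a₀ a₁ a₂ a₃ a₄ a₅ b₀ b₁ b₂ b₃ b₄ b₅ : ℂ}
    (hp : HasTrunc p a₀ a₁ a₂ a₃ a₄ a₅) (hr : HasTrunc r b₀ b₁ b₂ b₃ b₄ b₅) :
    HasTrunc (p * r) (a₀ * b₀) (a₀ * b₁ + a₁ * b₀) (a₀ * b₂ + a₁ * b₁ + a₂ * b₀)
      (a₀ * b₃ + a₁ * b₂ + a₂ * b₁ + a₃ * b₀)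
      (a₀ * b₄ + a₁ * b₃ + a₂ * b₂ + a₃ * b₁ + a₄ * b₀)
      (a₀ * b₅ + a₁ * b₄ + a₂ * b₃ + a₃ * b₂ + a₄ * b₁ + a₅ * b₀) := by
  obtain ⟨rfl, rfl, rfl, rfl, rfl, rfl⟩ := hp
  obtain ⟨rfl, rfl, rfl, rfl, rfl, rfl⟩ := hr
  simp only [HasTrunc, PowerSeries.coeff_mul, Finset.Nat.sum_antidiagonal_eq_sum_range_succ_mk,
    Finset.sum_range_succ, Finset.sum_range_zero, zero_add]
  simp

theorem hasTrunc_eP : HasTrunc eP 1 (-24) (-72) (-96) (-168) (-144) := by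
  have h2 : ArithmeticFunction.sigma 1 2 = 3 := by decide +kernel
  have h3 : ArithmeticFunction.sigma 1 3 = 4 := by decide +kernel
  have h4 : ArithmeticFunction.sigma 1 4 = 7 := by decide +kernel
  have h5 : ArithmeticFunction.sigma 1 5 = 6 := by decide +kernel
  simp only [HasTrunc, coeff_eP, h2, h3, h4, h5]
  norm_num

theorem hasTrunc_eQ : HasTrunc eQ 1 240 2160 6720 17520 30240 := by
  have h2 : ArithmeticFunction.sigma 3 2 = 9 := by decide +kernel
  have h3 : ArithmeticFunction.sigma 3 3 = 28 := by decide +kernel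
  have h4 : ArithmeticFunction.sigma 3 4 = 73 := by decide +kernel
  have h5 : ArithmeticFunction.sigma 3 5 = 126 := by decide +kernel
  simp only [HasTrunc, coeff_eQ, h2, h3, h4, h5]
  norm_num

theorem hasTrunc_eR : HasTrunc eR 1 (-504) (-16632) (-122976) (-532728) (-1575504) := by
  have h2 : ArithmeticFunction.sigma 5 2 = 33 := by decide +kernel
  have h3 : ArithmeticFunction.sigma 5 3 = 244 := by decide +kernel
  have h4 : ArithmeticFunction.sigma 5 4 = 1057 := by decide +kernel
  have h5 : ArithmeticFunction.sigma 5 5 = 3126 := by decide +kernel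
  simp only [HasTrunc, coeff_eR, h2, h3, h4, h5]
  norm_num

/-- The coordinate vector of `7449432883200 f_12`. -/
noncomputable def initialCoord : Fin 5 → PowerSeries ℂ :=
  ![13025 * eQ ^ 3 - 12796 * eR ^ 2, 3852 * (eQ * eR), -(2706 * eQ ^ 2), 27500 * eR,
    -(28875 * eQ)]

theorem isCoord_initialCoord : IsCoord 12 initialCoord := by
  have h8 : eQ ^ 2 ∈ MS 8 := by
    rw [pow_two]
    exact MS_mul eQ_mem eQ_mem (by norm_num)
  have h12 : eQ ^ 3 ∈ MS 12 := by
    rw [pow_succ]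
    exact MS_mul h8 eQ_mem (by norm_num)
  have h12' : eR ^ 2 ∈ MS 12 := by
    rw [pow_two]
    exact MS_mul eR_mem eR_mem (by norm_num)
  intro ℓ
  fin_cases ℓ
  · exact (MS 12).sub_mem (ofNat_mul_mem_MS h12 13025) (ofNat_mul_mem_MS h12' 12796)
  · exact ofNat_mul_mem_MS (MS_mul eQ_mem eR_mem (by norm_num)) 3852
  · exact (MS 8).neg_mem (ofNat_mul_mem_MS h8 2706)
  · exact ofNat_mul_mem_MS eR_mem 27500
  · exact (MS 4).neg_mem (ofNat_mul_mem_MS eQ_mem 28875)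

theorem toG_initialCoord_zero : toG initialCoord 0 =
    13025 * eQ ^ 3 - 12796 * eR ^ 2 + 3852 * eP * eQ * eR - 2706 * eP ^ 2 * eQ ^ 2 +
      27500 * eP ^ 3 * eR - 28875 * eP ^ 4 * eQ := by
  simp [toG, initialCoord]
  ring

theorem hasTrunc_initialCoord :
    HasTrunc (toG initialCoord 0) 0 0 0 0 0 7449432883200 := by
  have e : toG initialCoord 0 =
      (13025 : ℂ) • (eQ * eQ * eQ) - (12796 : ℂ) • (eR * eR) + (3852 : ℂ) • (eP * eQ * eR) -
        (2706 : ℂ) • ((eP * eQ) * (eP * eQ)) + (27500 : ℂ) • (eP * eP * eP * eR) -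
        (28875 : ℂ) • (eP * eP * eP * (eP * eQ)) := by
    rw [toG_initialCoord_zero]
    simp only [PowerSeries.smul_eq_C_mul, map_ofNat]
    ring
  have hPQ := hasTrunc_eP.mul hasTrunc_eQ
  have hPPP := (hasTrunc_eP.mul hasTrunc_eP).mul hasTrunc_eP
  have hQQQ := (hasTrunc_eQ.mul hasTrunc_eQ).mul hasTrunc_eQ
  norm_num at hPQ hPPP hQQQ
  have hRR := hasTrunc_eR.mul hasTrunc_eR
  have hPQR := hPQ.mul hasTrunc_eR
  have hPQPQ := hPQ.mul hPQ
  have hPPPR := hPPP.mul hasTrunc_eR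
  have hPPPPQ := hPPP.mul hPQ
  obtain ⟨q0, q1, q2, q3, q4, q5⟩ := hQQQ
  obtain ⟨r0, r1, r2, r3, r4, r5⟩ := hRR
  obtain ⟨s0, s1, s2, s3, s4, s5⟩ := hPQR
  obtain ⟨t0, t1, t2, t3, t4, t5⟩ := hPQPQ
  obtain ⟨u0, u1, u2, u3, u4, u5⟩ := hPPPR
  obtain ⟨v0, v1, v2, v3, v4, v5⟩ := hPPPPQ
  rw [e]
  simp only [HasTrunc, map_add, map_sub, PowerSeries.coeff_smul, q0, q1, q2, q3, q4, q5, r0, r1,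
    r2, r3, r4, r5, s0, s1, s2, s3, s4, s5, t0, t1, t2, t3, t4, t5, u0, u1, u2, u3, u4, u5,
    v0, v1, v2, v3, v4, v5]
  norm_num

theorem IsNormalizedExtremalQM.exists_coord {w : ℤ} {f : ℍ → ℂ}
    (hf : IsNormalizedExtremalQM w 4 f) : ∃ h u, IsCoord w h ∧ HasQ f (toG h 0) ∧
      toG h 0 = PowerSeries.X ^ (dimQM w 4 - 1) * u ∧ PowerSeries.constantCoeff u = 1 := by
  obtain ⟨hQM, a, ha0, ha⟩ := hf
  rw [QM_eq_range] at hQM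
  obtain ⟨F, rfl⟩ := hQM
  have hq : HasQ (quasiMap w F) (toG (fun ℓ => qExpansion 1 (F ℓ)) 0) := by
    have := HasQ.sum Finset.univ (fun (ℓ : Fin 5) _ =>
      (hasQ_Eis_two.pow (ℓ : ℕ)).mul (hasQ_modularForm (F ℓ)))
    convert this using 1
    · funext z
      simp [quasiMap_apply]
    · simp [toG, Fin.sum_univ_five]
  refine ⟨fun ℓ => qExpansion 1 (F ℓ), PowerSeries.mk a,
    fun ℓ => ⟨F ℓ, hasQ_modularForm (F ℓ)⟩, hq, hq.unique fun z => ?_, by simpa using ha0⟩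
  set N := dimQM w 4 - 1
  rw [← hasSum_nat_add_iff' N]
  have h0 : ∑ i ∈ Finset.range N, PowerSeries.coeff i (PowerSeries.X ^ N * PowerSeries.mk a) *
      qexp z ^ i = 0 := Finset.sum_eq_zero fun i hi => by
    rw [PowerSeries.X_pow_dvd_iff.mp (dvd_mul_right _ _) i (Finset.mem_range.mp hi), zero_mul]
  rw [h0, sub_zero]
  have hshift : ∀ n, PowerSeries.coeff (n + N) (PowerSeries.X ^ N * PowerSeries.mk a) *
      qexp z ^ (n + N) = a n * qexp z ^ (N + n) := fun n => by
    rw [PowerSeries.coeff_X_pow_mul, PowerSeries.coeff_mk, add_comm n N]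
  simpa only [hshift] using ha z

theorem HasQ.serre {f : ℍ → ℂ} {p : PowerSeries ℂ} (hf : HasQ f p) (n : ℤ) :
    HasQ (serre n f) ((1 / 12 : ℂ) • (theta p - (n : PowerSeries ℂ) * eP * p)) := by
  have h := (hf.qderiv.sub ((hasQ_Eis_two.mul hf).smul (n : ℂ))).smul (1 / 12 : ℂ)
  convert h using 1
  · funext z
    simp [_root_.serre]
    ring
  · rw [PowerSeries.smul_eq_C_mul (eP * p), map_intCast, mul_assoc]

theorem HasQ.serreIter {w : ℤ} {f : ℍ → ℂ} {h : Fin 5 → PowerSeries ℂ}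
    (hf : HasQ f (toG h 0)) : ∀ j : ℕ,
      HasQ (serreIter (w - 4) j f) ((1 / 12 : ℂ) ^ j • toG (serreRow w h j) 0)
  | 0 => by simpa [_root_.serreIter, serreRow] using hf
  | j + 1 => by
    have h := (hf.serreIter (w := w) j).serre (w - 4 + 2 * j)
    rw [_root_.serreIter]
    convert h using 1
    rw [toG_serreRow_succ_zero, Derivation.map_smul, mul_smul_comm, ← smul_sub, smul_smul, pow_succ']

theorem IsCoord.const_smul {w : ℤ} {h : Fin 5 → PowerSeries ℂ} (hh : IsCoord w h) (c : ℂ) :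
    IsCoord w (c • h) := fun ℓ => (MS _).smul_mem c (hh ℓ)

theorem toG_const_smul (c : ℂ) (v : Fin 5 → PowerSeries ℂ) : toG (c • v) = c • toG v := by
  funext i
  fin_cases i <;> simp [toG, PowerSeries.smul_eq_C_mul] <;> ring

/-- Two quasimodular forms of weight `w` and depth at most `4` whose expansions agree to an order
larger than `5w/12` are equal. -/
theorem IsCoord.ext {w : ℤ} {f g : ℍ → ℂ} {h k : Fin 5 → PowerSeries ℂ} (hh : IsCoord w h)
    (hk : IsCoord w k) (hf : HasQ f (toG h 0)) (hg : HasQ g (toG k 0)) {N : ℕ} (hN : 0 < N)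
    (hw : 5 * w < 12 * N) (hdvd : PowerSeries.X ^ N ∣ toG h 0 - toG k 0) : f = g := by
  have e : toG (h + (-1 : ℂ) • k) 0 = toG h 0 - toG k 0 := by
    rw [toG_add, toG_const_smul]
    simp [sub_eq_add_neg]
  have h0 := (hh.add (hk.const_smul (-1))).toG_eq_zero hN hw (by rwa [e])
  rw [e, sub_eq_zero] at h0
  rw [← h0] at hg
  exact hf.ext hg

theorem eq_initial {f : ℍ → ℂ} (hf : IsNormalizedExtremalQM 12 4 f) (z : ℍ) :
    f z = (13025 * Eis 4 z ^ 3 - 12796 * Eis 6 z ^ 2 + 3852 * Eis 2 z * Eis 4 z * Eis 6 z -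
          2706 * Eis 2 z ^ 2 * Eis 4 z ^ 2 + 27500 * Eis 2 z ^ 3 * Eis 6 z -
          28875 * Eis 2 z ^ 4 * Eis 4 z) / 7449432883200 := by
  obtain ⟨h, u, hh, hq, hu, hu0⟩ := hf.exists_coord
  have hd : dimQM 12 4 = 6 := by simpa using dimQM_zero_mod 1 one_pos
  rw [hd] at hu
  have P := hasQ_Eis_two
  have Q := hasQ_Eis_four
  have R := hasQ_Eis_six
  have hcand := ((((((Q.pow 3).smul 13025).sub ((R.pow 2).smul 12796)).add
    (((P.mul Q).mul R).smul 3852)).sub (((P.pow 2).mul (Q.pow 2)).smul 2706)).add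
    (((P.pow 3).mul R).smul 27500)).sub (((P.pow 4).mul Q).smul 28875) |>.smul
      (1 / 7449432883200)
  have e : toG ((1 / 7449432883200 : ℂ) • initialCoord) 0 =
      (1 / 7449432883200 : ℂ) • toG initialCoord 0 := by
    rw [toG_const_smul, Pi.smul_apply]
  have hf' := hh.ext (isCoord_initialCoord.const_smul (1 / 7449432883200)) hq (N := 6)
    (by
      rw [e, toG_initialCoord_zero]
      convert hcand using 2
      simp only [PowerSeries.smul_eq_C_mul, map_ofNat]
      ring) (by norm_num) (by norm_num) (by
      obtain ⟨c0, c1, c2, c3, c4, c5⟩ := hasTrunc_initialCoord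
      rw [e, PowerSeries.X_pow_dvd_iff]
      intro m hm
      rw [map_sub, PowerSeries.coeff_smul, hu, PowerSeries.coeff_X_pow_mul']
      interval_cases m <;> simp [*])
  rw [hf']
  simp
  ring



theorem first_recursion {k : ℕ} (hk : 0 < k) {f g : ℍ → ℂ}
    (hf : IsNormalizedExtremalQM (12 * k) 4 f) (hg : IsNormalizedExtremalQM (12 * k + 2) 4 g)
    (z : ℍ) : g z = 3 / (((12 * k : ℤ) : ℂ) + 1) * serre (12 * k - 4) f z := by
  obtain ⟨h, u, hh, hq, hu, hu0⟩ := hf.exists_coord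
  obtain ⟨h', u', hh', hq', hu', hu0'⟩ := hg.exists_coord
  rw [dimQM_zero_mod k hk, Nat.add_sub_cancel] at hu
  rw [dimQM_two_mod k hk, Nat.add_sub_cancel] at hu'
  have hν : 12 * ((5 * k : ℕ) : ℤ) = 5 * (12 * k : ℤ) := by push_cast; ring
  set w : ℤ := 12 * k with hw
  have hw1 : (w : ℂ) + 1 ≠ 0 := by
    have : w + 1 ≠ 0 := by omega
    exact_mod_cast this
  have hs := (hq.serreIter (w := w) 1).smul (3 / ((w : ℂ) + 1))
  have e : toG ((3 / ((w : ℂ) + 1) * (1 / 12) ^ 1) • serreRow w h 1) 0 =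
      (3 / ((w : ℂ) + 1)) • ((1 / 12 : ℂ) ^ 1 • toG (serreRow w h 1) 0) := by
    rw [toG_const_smul, smul_smul, Pi.smul_apply]
  have hr : IsCoord (w + 2) (serreRow w h 1) := by simpa using hh.serreRow 1
  have hfg := hh'.ext (hr.const_smul (3 / ((w : ℂ) + 1) * (1 / 12) ^ 1)) hq' (e ▸ hs)
    (N := 5 * k + 1) (by omega) (by push_cast; omega) (by
      rw [e, hu', toG_serreRow_zero hu 1, ← mul_smul_comm, ← mul_smul_comm, ← mul_sub, pow_succ]
      refine mul_dvd_mul_left _ (PowerSeries.X_dvd_iff.mpr ?_)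
      rw [map_sub, hu0', smul_smul, PowerSeries.smul_eq_C_mul, map_mul,
        PowerSeries.constantCoeff_C, constantCoeff_serreFactor_succ hν, serreFactor, hu0]
      field_simp
      push_cast
      ring)
  rw [hfg]
  simp [serreIter]

theorem second_recursion {k : ℕ} (hk : 0 < k) {f g : ℍ → ℂ}
    (hf : IsNormalizedExtremalQM (12 * k) 4 f) (hg : IsNormalizedExtremalQM (12 * k + 4) 4 g)
    (z : ℍ) : g z = (5 * ((12 * k : ℤ) : ℂ) + 12) ^ 4 /
      (2 ^ 6 * 3 ^ 5 * (((12 * k : ℤ) : ℂ) + 1) * (((12 * k : ℤ) : ℂ) + 2) ^ 5) *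
        ((((12 * k : ℤ) : ℂ) + 1) * (2 * ((12 * k : ℤ) : ℂ) + 1) / 18 * Eis 4 z * f z -
          serreIter (12 * k - 4) 2 f z) := by
  obtain ⟨h, u, hh, hq, hu, hu0⟩ := hf.exists_coord
  obtain ⟨h', u', hh', hq', hu', hu0'⟩ := hg.exists_coord
  rw [dimQM_zero_mod k hk, Nat.add_sub_cancel] at hu
  rw [dimQM_four_mod k hk, show 5 * k + 2 - 1 = 5 * k + 1 by omega] at hu'
  have hν : 12 * ((5 * k : ℕ) : ℤ) = 5 * (12 * k : ℤ) := by push_cast; ring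
  set w : ℤ := 12 * k with hw
  have hw1 : (w : ℂ) + 1 ≠ 0 := by
    have : w + 1 ≠ 0 := by omega
    exact_mod_cast this
  have hw2 : (w : ℂ) + 2 ≠ 0 := by
    have : w + 2 ≠ 0 := by omega
    exact_mod_cast this
  have hu_ne : u ≠ 0 := by
    rintro rfl
    simp at hu0
  have hode := hh.odeComb_serreFactor_eq_zero (by omega) hν hu hu_ne
  have hcoeff := coeff_one_of_odeComb_eq_zero hν hu0 hode
  set μ : ℂ := ((w : ℂ) + 1) * (2 * w + 1) / 18 with hμ
  set lam : ℂ := (5 * (w : ℂ) + 12) ^ 4 / (2 ^ 6 * 3 ^ 5 * ((w : ℂ) + 1) * ((w : ℂ) + 2) ^ 5)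
    with hlam
  have hD : 2 ^ 6 * 3 ^ 5 * ((w : ℂ) + 1) * ((w : ℂ) + 2) ^ 5 ≠ 0 :=
    mul_ne_zero (mul_ne_zero (by norm_num) hw1) (pow_ne_zero _ hw2)
  have hlamD := div_mul_cancel₀ ((5 * (w : ℂ) + 12) ^ 4) hD
  rw [← hlam] at hlamD
  have hs := ((((hasQ_Eis_four.mul hq).smul μ).sub (hq.serreIter (w := w) 2)).smul lam)
  have hcoord : IsCoord (w + 4) (lam • (μ • (eQ • h) +
      (-(1 / 12 : ℂ) ^ 2) • serreRow w h 2)) :=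
    (((IsCoord.smul eQ_mem hh (by ring)).const_smul μ).add
      (IsCoord.const_smul (hh.serreRow 2) _)).const_smul lam
  have e : toG (lam • (μ • (eQ • h) +
      (-(1 / 12 : ℂ) ^ 2) • serreRow w h 2)) 0 =
      lam • (μ • (eQ * toG h 0) - (1 / 12 : ℂ) ^ 2 • toG (serreRow w h 2) 0) := by
    simp only [toG_smul, toG_const_smul, toG_add, PowerSeries.smul_eq_C_mul, Pi.smul_apply,
      Pi.add_apply, smul_eq_mul, map_neg]
    ring
  have hb2 : PowerSeries.constantCoeff (serreFactor w (5 * k) u 2) = 144 * μ := by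
    rw [constantCoeff_serreFactor_succ hν, constantCoeff_serreFactor_succ hν, serreFactor, hu0]
    push_cast
    ring
  have hfg := hh'.ext hcoord hq' (e ▸ hs) (N := 5 * k + 2) (by omega) (by push_cast; omega) (by
    have e2 : PowerSeries.X ^ (5 * k + 1) * u' - lam • (μ • (eQ * (PowerSeries.X ^ (5 * k) * u)) -
        (1 / 12 : ℂ) ^ 2 • (PowerSeries.X ^ (5 * k) * serreFactor w (5 * k) u 2)) =
        PowerSeries.X ^ (5 * k) * (PowerSeries.X * u' - PowerSeries.C lam *
          (PowerSeries.C μ * (eQ * u) -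
            PowerSeries.C ((1 / 12 : ℂ) ^ 2) * serreFactor w (5 * k) u 2)) := by
      simp only [PowerSeries.smul_eq_C_mul]
      ring
    rw [e, hu', hu, toG_serreRow_zero hu 2, e2, pow_add]
    refine mul_dvd_mul_left _ (PowerSeries.X_pow_dvd_iff.mpr fun m hm => ?_)
    interval_cases m
    · rw [PowerSeries.coeff_zero_eq_constantCoeff_apply]
      simp only [map_sub, map_mul, PowerSeries.constantCoeff_X, PowerSeries.constantCoeff_C,
        constantCoeff_eQ, hu0, hb2]
      ring
    · have h1 : PowerSeries.coeff 1 (PowerSeries.X * u') = 1 := by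
        simp [hu0']
      rw [map_sub, h1, PowerSeries.coeff_C_mul, map_sub, PowerSeries.coeff_C_mul,
        PowerSeries.coeff_C_mul, PowerSeries.coeff_one_mul, constantCoeff_eQ, coeff_one_eQ, hu0]
      refine mul_left_cancel₀ hD ?_
      linear_combination (-1 : ℂ) * hcoeff - (μ * (PowerSeries.coeff 1 u + 240) -
        PowerSeries.coeff 1 (serreFactor w (5 * k) u 2) / 144) * hlamD)
  rw [hfg]
  simp only [Pi.smul_apply, Pi.sub_apply, Pi.mul_apply, smul_eq_mul]
  ring

/-- part of Proposition 10 of the paper: the initial form and the first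
two recursions for the normalized extremal quasimodular forms of depth `4`. -/
theorem depth_four_recursions (f : ℤ → ℍ → ℂ)
    (hf : ∀ w : ℤ, Even w → 12 ≤ w → IsNormalizedExtremalQM w 4 (f w)) :
    (∀ z : ℍ, f 12 z =
      (13025 * Eis 4 z ^ 3 - 12796 * Eis 6 z ^ 2 + 3852 * Eis 2 z * Eis 4 z * Eis 6 z -
          2706 * Eis 2 z ^ 2 * Eis 4 z ^ 2 + 27500 * Eis 2 z ^ 3 * Eis 6 z -
          28875 * Eis 2 z ^ 4 * Eis 4 z) / 7449432883200) ∧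
    ∀ w : ℤ, 12 ≤ w → w % 12 = 0 →
      ((∀ z : ℍ, f (w + 2) z = 3 / ((w : ℂ) + 1) * serre (w - 4) (f w) z) ∧
       (∀ z : ℍ, f (w + 4) z =
          (5 * (w : ℂ) + 12) ^ 4 / (2 ^ 6 * 3 ^ 5 * ((w : ℂ) + 1) * ((w : ℂ) + 2) ^ 5) *
            (((w : ℂ) + 1) * (2 * (w : ℂ) + 1) / 18 * Eis 4 z * f w z -
              serreIter (w - 4) 2 (f w) z))) := by
  refine ⟨eq_initial (hf 12 (by decide) le_rfl), fun w hw hmod => ?_⟩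
  obtain ⟨k, rfl⟩ : ∃ k : ℕ, w = 12 * k := ⟨(w / 12).toNat, by omega⟩
  have hk : 0 < k := by omega
  have hev : Even (12 * (k : ℤ)) := ⟨6 * k, by ring⟩
  exact ⟨first_recursion hk (hf _ hev hw) (hf _ (hev.add (by decide)) (by omega)),
    second_recursion hk (hf _ hev hw) (hf _ (hev.add (by decide)) (by omega))⟩
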